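/- arXiv:math/0101076 — 2 statements merged into one kernel-verified Lean document; each statement's English description precedes it below -/
import Mathlib

section
/- For integers n ≥ d ≥ 2 and 0 ≤ i ≤ d-1, the number of i-dimensional faces of the multiplex M^{d,n} equals C(d+1, i+1) + (n-d)·C(d-1, i). -/
open Set

variable {E : Type*} [NormedAddCommGroup E] [NormedSpace ℝ E]

/-- The dimension of a (nonempty convex) set: the dimension of its affine span. -/
noncomputable def pdim (F : Set E) : ℕ := Module.finrank ℝ (affineSpan ℝ F).direction

/-- `F` is a (nonempty) face of the polytope `P`. -/
def IsFaceOf (P F : Set E) : Prop := IsExposed ℝ P F ∧ F.Nonempty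

/-- The number of `i`-dimensional faces of `P`. -/
noncomputable def faceCount (P : Set E) (i : ℕ) : ℕ :=
  {F : Set E | IsFaceOf P F ∧ pdim F = i}.ncard

/-- The flag number `f_S(P)`: the number of chains of faces of `P` whose set of
dimensions is `S`.  A chain is recorded as a function `c : ℕ → Set E` that assigns
to each `s ∈ S` a face of dimension `s`, increasingly with `s`, and `∅` off `S`. -/
noncomputable def flagNum (P : Set E) (S : Finset ℕ) : ℕ :=
  {c : ℕ → Set E | (∀ s ∈ S, IsFaceOf P (c s) ∧ pdim (c s) = s) ∧
    (∀ s ∈ S, ∀ t ∈ S, s ≤ t → c s ⊆ c t) ∧ ∀ s, s ∉ S → c s = ∅}.ncard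

/-- `P` is the multiplex `M^{d,n}` with ordered vertices `x 0, …, x n`, where the
vertex list is extended to all integer indices by the conventions `x j = x 0` for
`j < 0` and `x j = x n` for `j > n`.  Its facets are exactly the sets
`F i = conv{x (i-d+1), …, x (i-1), x (i+1), …, x (i+d-1)}` for `0 ≤ i ≤ n`. -/
structure IsMultiplex (d n : ℕ) (P : Set E) (x : ℤ → E) : Prop where
  two_le_d : 2 ≤ d
  d_le_n : d ≤ n
  clamp_lo : ∀ j : ℤ, j ≤ 0 → x j = x 0
  clamp_hi : ∀ j : ℤ, (n : ℤ) ≤ j → x j = x n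
  inj : Set.InjOn x (Icc (0:ℤ) (n:ℤ))
  hull : P = convexHull ℝ (x '' Icc (0:ℤ) (n:ℤ))
  verts : Set.extremePoints ℝ P = x '' Icc (0:ℤ) (n:ℤ)
  dim : pdim P = d
  facets : ∀ F : Set E, (IsFaceOf P F ∧ pdim F = d - 1) ↔
      ∃ i ∈ Icc (0:ℤ) (n:ℤ),
        F = convexHull ℝ (x '' (Icc (i - d + 1) (i + d - 1) \ {i}))


/-! ### General facts on exposed faces of polytopes -/

lemma face_exists_functional {P F : Set E} (h : IsFaceOf P F) :
    ∃ (l : E →L[ℝ] ℝ) (c : ℝ), (∀ y ∈ P, l y ≤ c) ∧ F = {y ∈ P | l y = c} := by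
  obtain ⟨he, hne⟩ := h
  obtain ⟨l, hl⟩ := he hne
  obtain ⟨z, hz⟩ := hne
  have hz' := hz
  rw [hl] at hz'
  refine ⟨l, l z, hz'.2, ?_⟩
  rw [hl]
  ext y
  constructor
  · rintro ⟨hy, hy2⟩
    exact ⟨hy, le_antisymm (hz'.2 y hy) (hy2 z hz'.1)⟩
  · rintro ⟨hy, hy2⟩
    refine ⟨hy, fun w hw => ?_⟩
    have hy3 : l y = l z := hy2
    rw [hy3]
    exact hz'.2 w hw

lemma face_of_functional {P : Set E} (l : E →L[ℝ] ℝ) (c : ℝ) (h : ∀ y ∈ P, l y ≤ c)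
    (hne : {y ∈ P | l y = c}.Nonempty) : IsFaceOf P {y ∈ P | l y = c} := by
  refine ⟨fun _ => ⟨l, ?_⟩, hne⟩
  obtain ⟨z, hz, hzc⟩ := hne
  ext y
  constructor
  · rintro ⟨hy, hy2⟩
    refine ⟨hy, fun w hw => ?_⟩
    have hy3 : l y = c := hy2
    rw [hy3]
    exact h w hw
  · rintro ⟨hy, hy2⟩
    refine ⟨hy, le_antisymm (h y hy) ?_⟩
    have := hy2 z hz
    have hzc' : l z = c := hzc
    linarith

lemma face_eq_hull {S F : Set E} (hS : S.Finite) (h : IsFaceOf (convexHull ℝ S) F) :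
    F = convexHull ℝ (S ∩ F) := by
  have hcomp : IsCompact F := h.1.isCompact (hS.isCompact_convexHull (𝕜 := ℝ))
  have hconv : Convex ℝ F := h.1.convex (convex_convexHull ℝ S)
  have hsub : F.extremePoints ℝ ⊆ S ∩ F := by
    rw [h.1.isExtreme.extremePoints_eq]
    rintro y ⟨hy, hy2⟩
    exact ⟨extremePoints_convexHull_subset hy2, hy⟩
  apply Subset.antisymm
  · conv_lhs => rw [← closure_convexHull_extremePoints hcomp hconv]
    exact closure_minimal (convexHull_mono hsub)
      ((hS.subset inter_subset_left).isClosed_convexHull (𝕜 := ℝ))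
  · exact convexHull_min inter_subset_right hconv

lemma finiteDimensional_vectorSpan_hull {S : Set E} (hS : S.Finite) :
    FiniteDimensional ℝ (vectorSpan ℝ (convexHull ℝ S)) := by
  rw [← direction_affineSpan, affineSpan_convexHull, direction_affineSpan]
  exact finiteDimensional_vectorSpan_of_finite ℝ hS

lemma pdim_eq (F : Set E) : pdim F = Module.finrank ℝ (vectorSpan ℝ F) := by
  rw [pdim, direction_affineSpan]

lemma face_pdim_lt {S F G : Set E} (hS : S.Finite) (hF : IsFaceOf (convexHull ℝ S) F)
    (hG : IsFaceOf (convexHull ℝ S) G) (hFG : F ⊆ G) (hne : F ≠ G) : pdim F < pdim G := by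
  obtain ⟨l, c, hl, hFl⟩ := face_exists_functional hF
  obtain ⟨w, hwG, hwF⟩ : ∃ w ∈ G, w ∉ F := by
    by_contra hcon
    push Not at hcon
    exact hne (Subset.antisymm hFG hcon)
  obtain ⟨z, hz⟩ := hF.2
  have hfin := finiteDimensional_vectorSpan_hull hS
  have hGP : vectorSpan ℝ G ≤ vectorSpan ℝ (convexHull ℝ S) := vectorSpan_mono ℝ hG.1.subset
  have : FiniteDimensional ℝ (vectorSpan ℝ G) := Submodule.finiteDimensional_of_le hGP
  rw [pdim_eq, pdim_eq]
  apply Submodule.finrank_lt_finrank_of_lt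
  refine lt_of_le_of_ne (vectorSpan_mono ℝ hFG) fun heq => ?_
  have h1 : w - z ∈ vectorSpan ℝ G := vsub_mem_vectorSpan ℝ hwG (hFG hz)
  rw [← heq] at h1
  have h2 : vectorSpan ℝ F ≤ LinearMap.ker (l : E →ₗ[ℝ] ℝ) := by
    rw [vectorSpan_def, Submodule.span_le]
    rintro _ ⟨a, ha, b, hb, rfl⟩
    rw [hFl] at ha hb
    have ha' : l a = c := ha.2
    have hb' : l b = c := hb.2
    simp [ha', hb']
  have h3 := h2 h1
  have hz' : l z = c := by
    rw [hFl] at hz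
    exact hz.2
  have h4 : l w = c := by
    simp [hz', sub_eq_zero] at h3
    exact h3
  apply hwF
  rw [hFl]
  exact ⟨hG.1.subset hwG, h4⟩

lemma exists_functional_of_notMem (W : Submodule ℝ E) [FiniteDimensional ℝ W] (w : E)
    (hw : w ∉ W) : ∃ f : E →L[ℝ] ℝ, (∀ y ∈ W, f y = 0) ∧ 0 < f w := by
  obtain ⟨f, u, h1, h2⟩ := geometric_hahn_banach_point_closed (t := (W : Set E)) W.convex
    W.closed_of_finiteDimensional hw
  have hu : u < 0 := by simpa using h2 0 W.zero_mem
  refine ⟨-f, fun y hy => ?_, ?_⟩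
  · by_contra hne
    have hne' : f y ≠ 0 := by simpa using hne
    have := h2 (((u - 1) / f y) • y) (W.smul_mem _ hy)
    simp [hne'] at this
    linarith
  · simp
    linarith

/-- Rotation step: a face of codimension at least two missing the vertex `v` can be enlarged. -/
lemma face_enlarge {S F : Set E} (hS : S.Finite) (hF : IsFaceOf (convexHull ℝ S) F) {v : E}
    (hv : v ∈ S) (hvF : v ∉ F) (hdim : pdim F + 1 < pdim (convexHull ℝ S)) :
    ∃ F', IsFaceOf (convexHull ℝ S) F' ∧ F ⊆ F' ∧ F ≠ F' ∧ v ∉ F' := by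
  obtain ⟨l, c, hl, hFl⟩ := face_exists_functional hF
  obtain ⟨z, hz⟩ := hF.2
  have hzl : l z = c := by
    rw [hFl] at hz
    exact hz.2
  have hSP : S ⊆ convexHull ℝ S := subset_convexHull ℝ S
  have hfinP := finiteDimensional_vectorSpan_hull hS
  set W := vectorSpan ℝ (insert v F) with hW
  have hWle : W ≤ vectorSpan ℝ (convexHull ℝ S) :=
    vectorSpan_mono ℝ (insert_subset (hSP hv) hF.1.subset)
  have hWfin : FiniteDimensional ℝ W := Submodule.finiteDimensional_of_le hWle
  have hWdim : Module.finrank ℝ W ≤ pdim F + 1 := by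
    rw [pdim_eq]
    exact finrank_vectorSpan_insert_le_set ℝ F v
  obtain ⟨w, hwS, hwW⟩ : ∃ w ∈ S, w - z ∉ W := by
    by_contra hcon
    push Not at hcon
    have h1 : S ⊆ (AffineSubspace.mk' z W : Set E) := by
      intro y hy
      simpa [AffineSubspace.mem_mk'] using hcon y hy
    have h2 : affineSpan ℝ S ≤ AffineSubspace.mk' z W := affineSpan_le.2 h1
    have h3 := AffineSubspace.direction_le h2
    rw [AffineSubspace.direction_mk'] at h3
    have h4 := Submodule.finrank_mono h3
    have h5 : pdim (convexHull ℝ S) = Module.finrank ℝ (affineSpan ℝ S).direction := by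
      rw [pdim, affineSpan_convexHull]
    omega
  obtain ⟨g, hgW, hgw⟩ := exists_functional_of_notMem W _ hwW
  have hgF : ∀ y ∈ F, g (y - z) = 0 := fun y hy =>
    hgW _ (vsub_mem_vectorSpan ℝ (mem_insert_of_mem _ hy) (mem_insert_of_mem _ hz))
  have hgv : g (v - z) = 0 :=
    hgW _ (vsub_mem_vectorSpan ℝ (mem_insert _ _) (mem_insert_of_mem _ hz))
  -- minimal ratio
  have hpos : ∀ y ∈ S, 0 < g (y - z) → 0 < c - l y := by
    intro y hy hgy
    have h1 := hl y (hSP hy)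
    rcases lt_or_eq_of_le h1 with h | h
    · linarith
    · exfalso
      have : y ∈ F := by
        rw [hFl]
        exact ⟨hSP hy, h⟩
      have := hgF y this
      linarith
  have hfin2 : {y ∈ S | 0 < g (y - z)}.Finite := hS.subset (sep_subset _ _)
  obtain ⟨m, ⟨hmS, hmg⟩, hmin⟩ := Set.exists_min_image _ (fun y => (c - l y) / g (y - z)) hfin2
    ⟨w, hwS, hgw⟩
  set t := (c - l m) / g (m - z) with ht
  have htpos : 0 < t := div_pos (hpos m hmS hmg) hmg
  let l' : E →L[ℝ] ℝ := l + t • g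
  let c' : ℝ := c + t * g z
  have hl'S : ∀ y ∈ S, l' y ≤ c' := by
    intro y hy
    simp only [l', c', add_apply, smul_apply, smul_eq_mul]
    have h1 := hl y (hSP hy)
    have h2 : t * g (y - z) ≤ c - l y := by
      rcases lt_or_ge 0 (g (y - z)) with h | h
      · have := hmin y ⟨hy, h⟩
        rwa [le_div_iff₀ h] at this
      · nlinarith
    rw [map_sub] at h2
    linarith
  have hl'P : ∀ y ∈ convexHull ℝ S, l' y ≤ c' := by
    intro y hy
    have hcv : Convex ℝ {y : E | l' y ≤ c'} := convex_halfSpace_le l'.isLinear c'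
    exact convexHull_min (s := S) hl'S hcv hy
  have hval : ∀ y, l' y = l y + t * g (y - z) + t * g z := by
    intro y
    simp [l']
    ring
  have hFF' : F ⊆ {y ∈ convexHull ℝ S | l' y = c'} := by
    intro y hy
    refine ⟨hF.1.subset hy, ?_⟩
    have hyl : l y = c := by
      rw [hFl] at hy
      exact hy.2
    rw [hval, hgF y hy, hyl]
    simp [c']
  refine ⟨_, face_of_functional l' c' hl'P ⟨z, hFF' hz⟩, hFF', ?_, ?_⟩
  · intro heq
    have hm : m ∈ F := by
      rw [heq]
      refine ⟨hSP hmS, ?_⟩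
      rw [hval, ht, div_mul_cancel₀ _ hmg.ne']
      simp only [c', ht]
      ring
    have := hgF m hm
    linarith
  · rintro ⟨-, h⟩
    rw [hval, hgv] at h
    apply hvF
    rw [hFl]
    refine ⟨hSP hv, ?_⟩
    simpa [c'] using h

lemma face_in_facet {S : Set E} (hS : S.Finite) {v : E} (hv : v ∈ S) :
    ∀ (k : ℕ) (F : Set E), IsFaceOf (convexHull ℝ S) F → v ∉ F →
      pdim (convexHull ℝ S) ≤ pdim F + k →
      ∃ F', IsFaceOf (convexHull ℝ S) F' ∧ pdim F' = pdim (convexHull ℝ S) - 1 ∧ F ⊆ F' ∧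
        v ∉ F' := by
  intro k
  induction k with
  | zero =>
    intro F hF hvF hk
    have hP : IsFaceOf (convexHull ℝ S) (convexHull ℝ S) :=
      ⟨IsExposed.refl _, ⟨v, subset_convexHull ℝ S hv⟩⟩
    have := face_pdim_lt hS hF hP hF.1.subset
      (fun h => hvF (h ▸ subset_convexHull ℝ S hv))
    omega
  | succ k ih =>
    intro F hF hvF hk
    have hP : IsFaceOf (convexHull ℝ S) (convexHull ℝ S) :=
      ⟨IsExposed.refl _, ⟨v, subset_convexHull ℝ S hv⟩⟩
    have hlt := face_pdim_lt hS hF hP hF.1.subset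
      (fun h => hvF (h ▸ subset_convexHull ℝ S hv))
    by_cases hd : pdim F + 1 < pdim (convexHull ℝ S)
    · obtain ⟨F', h1, h2, h3, h4⟩ := face_enlarge hS hF hv hvF hd
      have h5 := face_pdim_lt hS hF h1 h2 h3
      obtain ⟨F'', g1, g2, g3, g4⟩ := ih F' h1 h4 (by omega)
      exact ⟨F'', g1, g2, h2.trans g3, g4⟩
    · exact ⟨F, hF, by omega, Subset.rfl, hvF⟩

/-! ### Combinatorics of the vertex-facet incidence of the multiplex -/

/-- Incidence of vertex `j` with facet `i`. -/
def Inc (d n : ℕ) (i j : ℤ) : Prop :=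
  (i ≠ j ∨ i = 0 ∨ i = n) ∧ i ≤ j + d - 1 ∧ j ≤ i + d - 1

open Classical in
/-- Vertices common to all the facets in `T` (equivalently, facets containing all of `T`). -/
noncomputable def Vx (d n : ℕ) (T : Finset ℤ) : Finset ℤ :=
  (Finset.Icc (0 : ℤ) n).filter (fun j => ∀ t ∈ T, Inc d n t j)

/-- Nonempty sets of diameter at most `d - 2`. -/
def SmallDiam (d n : ℕ) (G : Finset ℤ) : Prop :=
  G ⊆ Finset.Icc (0 : ℤ) n ∧ G.Nonempty ∧ ∀ p ∈ G, ∀ q ∈ G, q + 2 ≤ p + d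

lemma Inc_symm {d n : ℕ} {i j : ℤ} (h : Inc d n i j) : Inc d n j i := by
  unfold Inc at *
  omega

lemma mem_Vx {d n : ℕ} {T : Finset ℤ} {j : ℤ} :
    j ∈ Vx d n T ↔ (0 ≤ j ∧ j ≤ n) ∧ ∀ t ∈ T, Inc d n t j := by
  simp [Vx]

lemma Vx_anti {d n : ℕ} {T T' : Finset ℤ} (h : T ⊆ T') : Vx d n T' ⊆ Vx d n T := by
  intro j hj
  rw [mem_Vx] at *
  exact ⟨hj.1, fun t ht => hj.2 t (h ht)⟩

lemma SmallDiam.ends {d n : ℕ} (hd : 2 ≤ d) (hdn : d ≤ n) {G : Finset ℤ} (h : SmallDiam d n G) :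
    ∃ p ∈ G, ∃ q ∈ G, (∀ g ∈ G, p ≤ g ∧ g ≤ q) ∧
      max 0 (q - d + 1) ∈ Vx d n G ∧ min (n : ℤ) (p + d - 1) ∈ Vx d n G := by
  obtain ⟨h1, h2, h3⟩ := h
  have hr : ∀ g ∈ G, 0 ≤ g ∧ g ≤ n := fun g hg => by simpa using h1 hg
  have hp := G.min'_mem h2
  have hq := G.max'_mem h2
  have hpq : ∀ g ∈ G, G.min' h2 ≤ g ∧ g ≤ G.max' h2 :=
    fun g hg => ⟨G.min'_le g hg, G.le_max' g hg⟩
  generalize G.min' h2 = p at *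
  generalize G.max' h2 = q at *
  have hd3 := h3 p hp q hq
  have hrp := hr p hp
  have hrq := hr q hq
  refine ⟨p, hp, q, hq, hpq, ?_, ?_⟩
  · rw [mem_Vx]
    refine ⟨by omega, fun g hg => ?_⟩
    have := hpq g hg
    have := hr g hg
    unfold Inc
    omega
  · rw [mem_Vx]
    refine ⟨by omega, fun g hg => ?_⟩
    have := hpq g hg
    have := hr g hg
    unfold Inc
    omega

lemma SmallDiam.Vx_nonempty {d n : ℕ} (hd : 2 ≤ d) (hdn : d ≤ n) {G : Finset ℤ} (h : SmallDiam d n G) :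
    (Vx d n G).Nonempty := by
  obtain ⟨p, hp, q, hq, hpq, h1, h2⟩ := h.ends hd hdn
  exact ⟨_, h1⟩

lemma SmallDiam.Vx_Vx {d n : ℕ} (hd : 2 ≤ d) (hdn : d ≤ n) {G : Finset ℤ} (h : SmallDiam d n G) :
    Vx d n (Vx d n G) = G := by
  obtain ⟨p, hp, q, hq, hpq, hA, hB⟩ := h.ends hd hdn
  obtain ⟨h1, h2, h3⟩ := h
  have hr : ∀ g ∈ G, 0 ≤ g ∧ g ≤ n := fun g hg => by simpa using h1 hg
  have hd3 := h3 p hp q hq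
  have hrp := hr p hp
  have hrq := hr q hq
  ext j
  constructor
  · intro hj
    rw [mem_Vx] at hj
    by_contra hjG
    have hjp : j ≠ p := fun e => hjG (e ▸ hp)
    have hjq : j ≠ q := fun e => hjG (e ▸ hq)
    have iA := hj.2 _ hA
    have iB := hj.2 _ hB
    have hj0 := hj.1
    by_cases hmid : 0 < j ∧ j < n ∧ q - d + 1 ≤ j ∧ j ≤ p + d - 1
    · have hjV : j ∈ Vx d n G := by
        rw [mem_Vx]
        refine ⟨hj.1, fun g hg => ?_⟩
        have hne : g ≠ j := fun e => hjG (e ▸ hg)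
        have := hpq g hg
        unfold Inc
        omega
      have := hj.2 _ hjV
      unfold Inc at this
      omega
    · unfold Inc at iA iB
      omega
  · intro hj
    rw [mem_Vx]
    refine ⟨hr j hj, fun t ht => ?_⟩
    rw [mem_Vx] at ht
    exact Inc_symm (ht.2 j hj)

lemma SmallDiam.not_Vx {d n : ℕ} (hd : 2 ≤ d) (hdn : d ≤ n) {G : Finset ℤ} (h : SmallDiam d n G) :
    ¬ SmallDiam d n (Vx d n G) := by
  intro hV
  obtain ⟨p, hp, q, hq, hpq, hA, hB⟩ := h.ends hd hdn
  have h3 := hV.2.2 _ hA _ hB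
  have hd3 := h.2.2 p hp q hq
  have hp0 := Finset.mem_Icc.1 (h.1 hp)
  have hq0 := Finset.mem_Icc.1 (h.1 hq)
  omega

lemma small_or_small {d n : ℕ} (hd : 2 ≤ d) (hdn : d ≤ n) {G : Finset ℤ}
    (hG : G ⊆ Finset.Icc (0 : ℤ) n) (hne : G.Nonempty) (hV : (Vx d n G).Nonempty) :
    SmallDiam d n G ∨ SmallDiam d n (Vx d n G) := by
  by_contra hcon
  rw [not_or] at hcon
  obtain ⟨h1, h2⟩ := hcon
  have h1' : ∃ p ∈ G, ∃ q ∈ G, p + d < q + 2 := by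
    by_contra hh
    push Not at hh
    exact h1 ⟨hG, hne, hh⟩
  have h2' : ∃ p ∈ Vx d n G, ∃ q ∈ Vx d n G, p + d < q + 2 := by
    by_contra hh
    push Not at hh
    exact h2 ⟨fun g hg => by simpa using (mem_Vx.1 hg).1, hV, hh⟩
  obtain ⟨p, hp, q, hq, hpq⟩ := h1'
  obtain ⟨a, ha, b, hb, hab⟩ := h2'
  rw [mem_Vx] at ha hb
  have i1 := ha.2 p hp
  have i2 := ha.2 q hq
  have i3 := hb.2 p hp
  have i4 := hb.2 q hq
  unfold Inc at *
  omega

lemma SmallDiam.mono {d n : ℕ} {G G' : Finset ℤ} (h : SmallDiam d n G) (hs : G' ⊆ G)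
    (hne : G'.Nonempty) : SmallDiam d n G' :=
  ⟨hs.trans h.1, hne, fun p hp q hq => h.2.2 p (hs hp) q (hs hq)⟩

lemma SmallDiam.window {d n : ℕ} (hd : 2 ≤ d) (hdn : d ≤ n) {T : Finset ℤ} (h : SmallDiam d n T) :
    ∃ W, SmallDiam d n W ∧ T ⊆ W ∧ W.card + 1 = d ∧
      ∃ u ∈ Vx d n W, ∃ v ∈ Vx d n W, u ≠ v := by
  obtain ⟨p, hp, q, hq, hpq, hA, hB⟩ := h.ends hd hdn
  obtain ⟨h1, h2, h3⟩ := h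
  have hr : ∀ g ∈ T, 0 ≤ g ∧ g ≤ n := fun g hg => by simpa using h1 hg
  have hd3 := h3 p hp q hq
  have hrp := hr p hp
  have hrq := hr q hq
  obtain ⟨a, ha⟩ : ∃ a : ℤ, a = min p (n - d + 2) := ⟨_, rfl⟩
  refine ⟨Finset.Icc a (a + d - 2), ⟨?_, ⟨a, ?_⟩, ?_⟩, ?_, ?_, max 0 (a - 1), ?_,
    min (n : ℤ) (a + d - 1), ?_, by omega⟩
  · intro g hg
    rw [Finset.mem_Icc] at *
    omega
  · rw [Finset.mem_Icc]
    omega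
  · intro p hp q hq
    rw [Finset.mem_Icc] at *
    omega
  · intro g hg
    have := hpq g hg
    have := hr g hg
    rw [Finset.mem_Icc]
    omega
  · rw [Int.card_Icc]
    omega
  · rw [mem_Vx]
    refine ⟨by omega, fun t ht => ?_⟩
    rw [Finset.mem_Icc] at ht
    unfold Inc
    omega
  · rw [mem_Vx]
    refine ⟨by omega, fun t ht => ?_⟩
    rw [Finset.mem_Icc] at ht
    unfold Inc
    omega

open Classical in
/-- The `k`-element sets of diameter at most `d - 2`. -/
noncomputable def smallSets (d n k : ℕ) : Finset (Finset ℤ) :=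
  ((Finset.Icc (0 : ℤ) n).powersetCard k).filter (fun G => ∀ p ∈ G, ∀ q ∈ G, q + 2 ≤ p + d)

lemma mem_smallSets {d n k : ℕ} (hk : 1 ≤ k) {G : Finset ℤ} :
    G ∈ smallSets d n k ↔ SmallDiam d n G ∧ G.card = k := by
  simp only [smallSets, SmallDiam, Finset.mem_filter, Finset.mem_powersetCard]
  constructor
  · rintro ⟨⟨h1, h2⟩, h3⟩
    exact ⟨⟨h1, Finset.card_pos.1 (by omega), h3⟩, h2⟩
  · rintro ⟨⟨h1, h2, h3⟩, h4⟩
    exact ⟨⟨h1, h4⟩, h3⟩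

lemma card_smallSets_aux (e m r : ℕ) :
    (smallSets (e + 2) (e + r) (m + 1)).card = (e + 1).choose (m + 1) + r * e.choose m := by
  classical
  induction r with
  | zero =>
    have h : smallSets (e + 2) (e + 0) (m + 1) = (Finset.Icc (0 : ℤ) e).powersetCard (m + 1) := by
      unfold smallSets
      rw [Finset.filter_true_of_mem]
      · simp
      · intro G hG p hp q hq
        rw [Finset.mem_powersetCard] at hG
        have h1 := hG.1 hp
        have h2 := hG.1 hq
        rw [Finset.mem_Icc] at h1 h2
        push_cast at *
        omega
    rw [h, Finset.card_powersetCard, Int.card_Icc]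
    simp
  | succ r ih =>
    set N : ℤ := ((e + (r + 1) : ℕ) : ℤ) with hN
    have h : smallSets (e + 2) (e + (r + 1)) (m + 1) = smallSets (e + 2) (e + r) (m + 1) ∪
        ((Finset.Icc (N - e) (N - 1)).powersetCard m).image (insert N) := by
      ext G
      simp only [smallSets, Finset.mem_union, Finset.mem_filter, Finset.mem_powersetCard,
        Finset.mem_image]
      constructor
      · rintro ⟨⟨h1, h2⟩, h3⟩
        by_cases hG : N ∈ G
        · right
          refine ⟨G.erase N, ⟨?_, ?_⟩, Finset.insert_erase hG⟩
          · intro g hg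
            rw [Finset.mem_erase] at hg
            have g1 := h1 hg.2
            have g2 := h3 g hg.2 N hG
            rw [Finset.mem_Icc] at *
            push_cast at *
            omega
          · rw [Finset.card_erase_of_mem hG]
            omega
        · left
          refine ⟨⟨fun g hg => ?_, h2⟩, h3⟩
          have g1 := h1 hg
          have g2 : g ≠ N := fun e => hG (e ▸ hg)
          rw [Finset.mem_Icc] at *
          push_cast at *
          omega
      · rintro (⟨⟨h1, h2⟩, h3⟩ | ⟨G', ⟨h1, h2⟩, rfl⟩)
        · refine ⟨⟨fun g hg => ?_, h2⟩, h3⟩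
          have g1 := h1 hg
          rw [Finset.mem_Icc] at *
          push_cast at *
          omega
        · have hb : ∀ g ∈ G', N - e ≤ g ∧ g ≤ N - 1 := fun g hg => by
            simpa using h1 hg
          have hb' : ∀ g ∈ insert N G', N - e ≤ g ∧ g ≤ N := by
            intro g hg
            rw [Finset.mem_insert] at hg
            rcases hg with rfl | hg
            · omega
            · have := hb g hg
              omega
          refine ⟨⟨fun g hg => ?_, ?_⟩, fun p hp q hq => ?_⟩
          · have := hb' g hg
            rw [Finset.mem_Icc]
            push_cast at *
            omega
          · rw [Finset.card_insert_of_notMem, h2]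
            intro hN'
            have := hb N hN'
            omega
          · have := hb' p hp
            have := hb' q hq
            push_cast
            omega
    rw [h, Finset.card_union_of_disjoint, ih, Finset.card_image_of_injOn, Finset.card_powersetCard,
      Int.card_Icc]
    · have : (N - 1 + 1 - (N - e)).toNat = e := by omega
      rw [this]
      ring
    · intro A hA B hB hAB
      simp only [Finset.mem_coe,
        Finset.mem_powersetCard] at hA hB
      have hA' : N ∉ A := fun h => by
        have := hA.1 h
        rw [Finset.mem_Icc] at this
        omega
      have hB' : N ∉ B := fun h => by
        have := hB.1 h
        rw [Finset.mem_Icc] at this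
        omega
      have := congrArg (fun s => Finset.erase s N) hAB
      simpa [Finset.erase_insert hA', Finset.erase_insert hB'] using this
    · rw [Finset.disjoint_left]
      intro G hG hG'
      simp only [smallSets, Finset.mem_filter, Finset.mem_powersetCard, Finset.mem_image] at hG hG'
      obtain ⟨G', -, rfl⟩ := hG'
      have := hG.1.1 (Finset.mem_insert_self N G')
      rw [Finset.mem_Icc] at this
      push_cast at *
      omega

lemma count_formula {d n i : ℕ} (hd : 2 ≤ d) (hdn : d ≤ n) (hi : i ≤ d - 1) :
    (smallSets d n (i + 1)).card + (smallSets d n (d - i)).card =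
      (d + 1).choose (i + 1) + (n - d) * (d - 1).choose i := by
  obtain ⟨e, rfl⟩ : ∃ e, d = e + 2 := ⟨d - 2, by omega⟩
  obtain ⟨s, rfl⟩ : ∃ s, n = e + (s + 2) := ⟨n - (e + 2), by omega⟩
  obtain ⟨m, hm⟩ : ∃ m, e + 2 - i = m + 1 := ⟨e + 1 - i, by omega⟩
  rw [hm, card_smallSets_aux, card_smallSets_aux]
  have h1 : e + (s + 2) - (e + 2) = s := by omega
  have h2 : e + 2 - 1 = e + 1 := by omega
  rw [h1, h2]
  have h3 : m = e + 1 - i := by omega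
  rcases i with _ | j
  · have : m = e + 1 := by omega
    subst this
    simp
    ring
  · have e1 : (e + 1).choose (m + 1) = (e + 1).choose j := by
      apply Nat.choose_symm_of_eq_add
      omega
    have e2 : e.choose m = e.choose j := by
      apply Nat.choose_symm_of_eq_add
      omega
    rw [e1, e2, Nat.choose_succ_succ (e + 2) (j + 1), Nat.choose_succ_succ (e + 1) j,
      Nat.choose_succ_succ (e + 1) (j + 1), Nat.choose_succ_succ e j]
    ring

/-! ### Faces of the multiplex -/

/-- The facet `F t`. -/
def mfacet (d : ℕ) (x : ℤ → E) (t : ℤ) : Set E :=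
  convexHull ℝ (x '' (Icc (t - d + 1) (t + d - 1) \ {t}))

/-- The intersection of the facets indexed by `T`. -/
def mface (d : ℕ) (x : ℤ → E) (T : Finset ℤ) : Set E := ⋂ t ∈ T, mfacet d x t

open Classical in
/-- The indices of the vertices lying in `F`. -/
noncomputable def vs (n : ℕ) (x : ℤ → E) (F : Set E) : Finset ℤ :=
  (Finset.Icc (0 : ℤ) n).filter (fun j => x j ∈ F)

lemma mem_vs {n : ℕ} {x : ℤ → E} {F : Set E} {j : ℤ} :
    j ∈ vs n x F ↔ (0 ≤ j ∧ j ≤ n) ∧ x j ∈ F := by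
  simp [vs]

section Multiplex

variable {d n : ℕ} {P : Set E} {x : ℤ → E}

lemma IsMultiplex.facet_face (hM : IsMultiplex d n P x) {t : ℤ} (h0 : 0 ≤ t) (hn : t ≤ n) :
    IsFaceOf P (mfacet d x t) ∧ pdim (mfacet d x t) = d - 1 :=
  (hM.facets _).2 ⟨t, ⟨h0, hn⟩, rfl⟩

lemma IsMultiplex.mem_facet (hM : IsMultiplex d n P x) {t j : ℤ} (h0 : 0 ≤ t) (hn : t ≤ n)
    (hj0 : 0 ≤ j) (hjn : j ≤ n) : x j ∈ mfacet d x t ↔ Inc d n t j := by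
  have hd := hM.two_le_d
  have hdn := hM.d_le_n
  constructor
  · intro h
    have hext : x j ∈ P.extremePoints ℝ := by
      rw [hM.verts]
      exact ⟨j, ⟨hj0, hjn⟩, rfl⟩
    have h2 : x j ∈ (mfacet d x t).extremePoints ℝ :=
      inter_extremePoints_subset_extremePoints_of_subset (hM.facet_face h0 hn).1.1.subset ⟨h, hext⟩
    obtain ⟨k, ⟨⟨hk1, hk2⟩, hk3⟩, hk4⟩ := extremePoints_convexHull_subset h2
    have hk3' : k ≠ t := hk3
    have hkj : max 0 (min k n) = j := by
      apply hM.inj (by constructor <;> omega) ⟨hj0, hjn⟩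
      rw [← hk4]
      rcases lt_or_ge k 0 with h | h
      · rw [hM.clamp_lo k h.le]
        congr 1
        omega
      · rcases lt_or_ge (n : ℤ) k with h' | h'
        · rw [hM.clamp_hi k h'.le]
          congr 1
          omega
        · congr 1
          omega
    unfold Inc
    omega
  · intro h
    apply subset_convexHull
    unfold Inc at h
    by_cases hne : t = j
    · subst hne
      rcases h.1 with h | h | h
      · exact absurd rfl h
      · refine ⟨-1, ⟨⟨by omega, by omega⟩, ?_⟩, ?_⟩
        · simp only [mem_singleton_iff]
          omega
        · rw [hM.clamp_lo _ (by omega), h]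
      · refine ⟨n + 1, ⟨⟨by omega, by omega⟩, ?_⟩, ?_⟩
        · simp only [mem_singleton_iff]
          omega
        · rw [hM.clamp_hi _ (by omega), h]
    · refine ⟨j, ⟨⟨by omega, by omega⟩, ?_⟩, rfl⟩
      simp only [mem_singleton_iff]
      omega

lemma IsMultiplex.finite_verts : (x '' Icc (0 : ℤ) n).Finite :=
  (Set.finite_Icc _ _).image _

lemma IsMultiplex.face_hull (hM : IsMultiplex d n P x) {F : Set E} (hF : IsFaceOf P F) :
    F = convexHull ℝ (x '' (vs n x F : Set ℤ)) := by
  have h := hF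
  rw [hM.hull] at h
  conv_lhs => rw [face_eq_hull IsMultiplex.finite_verts h]
  congr 1
  ext y
  constructor
  · rintro ⟨⟨j, hj, rfl⟩, hy⟩
    exact ⟨j, mem_vs.2 ⟨hj, hy⟩, rfl⟩
  · rintro ⟨j, hj, rfl⟩
    have := mem_vs.1 hj
    exact ⟨⟨j, this.1, rfl⟩, this.2⟩

lemma IsMultiplex.face_subset (hM : IsMultiplex d n P x) {F G : Set E} (hF : IsFaceOf P F)
    (hG : IsFaceOf P G) (h : vs n x F ⊆ vs n x G) : F ⊆ G := by
  rw [hM.face_hull hF, hM.face_hull hG]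
  exact convexHull_mono (image_mono (by exact_mod_cast h))

lemma IsMultiplex.face_ext (hM : IsMultiplex d n P x) {F G : Set E} (hF : IsFaceOf P F)
    (hG : IsFaceOf P G) (h : vs n x F = vs n x G) : F = G :=
  (hM.face_subset hF hG h.le).antisymm (hM.face_subset hG hF h.ge)

lemma IsMultiplex.vs_nonempty (hM : IsMultiplex d n P x) {F : Set E} (hF : IsFaceOf P F) :
    (vs n x F).Nonempty := by
  have h := hF.2
  rw [hM.face_hull hF, convexHull_nonempty_iff, image_nonempty] at h
  exact_mod_cast h

lemma vs_subset {F : Set E} : vs n x F ⊆ Finset.Icc (0 : ℤ) n := fun j hj => by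
  simpa using (mem_vs.1 hj).1

lemma IsMultiplex.pdim_lt (hM : IsMultiplex d n P x) {F G : Set E} (hF : IsFaceOf P F)
    (hG : IsFaceOf P G) (hFG : F ⊆ G) (hne : F ≠ G) : pdim F < pdim G := by
  rw [hM.hull] at hF hG
  exact face_pdim_lt IsMultiplex.finite_verts hF hG hFG hne

lemma IsMultiplex.vs_mface (hM : IsMultiplex d n P x) {T : Finset ℤ}
    (hT : T ⊆ Finset.Icc (0 : ℤ) n) : vs n x (mface d x T) = Vx d n T := by
  ext j
  rw [mem_vs, mem_Vx]
  refine and_congr_right fun hj => ?_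
  simp only [mface, mem_iInter]
  refine forall₂_congr fun t ht => ?_
  have := Finset.mem_Icc.1 (hT ht)
  exact hM.mem_facet this.1 this.2 hj.1 hj.2

lemma IsMultiplex.mface_face (hM : IsMultiplex d n P x) {T : Finset ℤ}
    (hT : T ⊆ Finset.Icc (0 : ℤ) n) (hne : T.Nonempty) (hV : (Vx d n T).Nonempty) :
    IsFaceOf P (mface d x T) := by
  classical
  constructor
  · have h : mface d x T = ⋂₀ ((T.image (mfacet d x) : Finset (Set E)) : Set (Set E)) := by
      simp [mface]
    rw [h]
    apply IsExposed.sInter (hne.image _)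
    intro B hB
    obtain ⟨t, ht, rfl⟩ := Finset.mem_image.1 hB
    have := Finset.mem_Icc.1 (hT ht)
    exact (hM.facet_face this.1 this.2).1.1
  · obtain ⟨j, hj⟩ := hV
    rw [← hM.vs_mface hT] at hj
    exact ⟨x j, (mem_vs.1 hj).2⟩

lemma IsMultiplex.exists_facet (hM : IsMultiplex d n P x) {F : Set E} (hF : IsFaceOf P F)
    {j : ℤ} (hj0 : 0 ≤ j) (hjn : j ≤ n) (hj : x j ∉ F) :
    ∃ t ∈ Vx d n (vs n x F), ¬ Inc d n t j := by
  have hF' := hF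
  rw [hM.hull] at hF'
  obtain ⟨F', h1, h2, h3, h4⟩ := face_in_facet (v := x j) IsMultiplex.finite_verts
    ⟨j, ⟨hj0, hjn⟩, rfl⟩ _ F hF' hj (Nat.le_add_left _ _)
  rw [← hM.hull] at h1 h2
  rw [hM.dim] at h2
  obtain ⟨t, ht, rfl⟩ := (hM.facets F').1 ⟨h1, h2⟩
  refine ⟨t, ?_, ?_⟩
  · rw [mem_Vx]
    refine ⟨ht, fun k hk => ?_⟩
    rw [mem_vs] at hk
    exact Inc_symm ((hM.mem_facet ht.1 ht.2 hk.1.1 hk.1.2).1 (h3 hk.2))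
  · rw [← hM.mem_facet ht.1 ht.2 hj0 hjn]
    exact h4

lemma Vx_subset {T : Finset ℤ} : Vx d n T ⊆ Finset.Icc (0 : ℤ) n := fun j hj => by
  simpa using (mem_Vx.1 hj).1

lemma IsMultiplex.Vx_vs (hM : IsMultiplex d n P x) {F : Set E} (hF : IsFaceOf P F) :
    Vx d n (Vx d n (vs n x F)) = vs n x F := by
  ext j
  constructor
  · intro hj
    rw [mem_Vx] at hj
    rw [mem_vs]
    refine ⟨hj.1, ?_⟩
    by_contra hcon
    obtain ⟨t, ht, ht2⟩ := hM.exists_facet hF hj.1.1 hj.1.2 hcon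
    exact ht2 (hj.2 t ht)
  · intro hj
    rw [mem_Vx]
    refine ⟨(mem_vs.1 hj).1, fun t ht => ?_⟩
    exact Inc_symm ((mem_Vx.1 ht).2 j hj)

lemma IsMultiplex.Vx_vs_nonempty (hM : IsMultiplex d n P x) {F : Set E} (hF : IsFaceOf P F)
    (hdim : pdim F < d) : (Vx d n (vs n x F)).Nonempty := by
  by_contra hcon
  have hall : ∀ j : ℤ, 0 ≤ j → j ≤ n → x j ∈ F := by
    intro j h0 h1
    by_contra hj
    obtain ⟨t, ht, -⟩ := hM.exists_facet hF h0 h1 hj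
    exact hcon ⟨t, ht⟩
  have hPF : P ⊆ F := by
    conv_lhs => rw [hM.hull]
    refine convexHull_min ?_ (hF.1.convex ?_)
    · rintro _ ⟨j, hj, rfl⟩
      exact hall j hj.1 hj.2
    · rw [hM.hull]
      exact convex_convexHull ℝ _
  have : F = P := hF.1.subset.antisymm hPF
  rw [this, hM.dim] at hdim
  exact lt_irrefl _ hdim

lemma IsMultiplex.mface_lt (hM : IsMultiplex d n P x) {T T' : Finset ℤ}
    (hT : SmallDiam d n T) (hT' : SmallDiam d n T') (h : T ⊂ T') :
    pdim (mface d x T') < pdim (mface d x T) := by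
  have hd := hM.two_le_d
  have hdn := hM.d_le_n
  apply hM.pdim_lt (hM.mface_face hT'.1 hT'.2.1 (hT'.Vx_nonempty hd hdn))
    (hM.mface_face hT.1 hT.2.1 (hT.Vx_nonempty hd hdn))
  · exact biInter_mono h.subset fun _ _ => Subset.rfl
  · intro heq
    have h1 := congrArg (vs n x) heq
    rw [hM.vs_mface hT'.1, hM.vs_mface hT.1] at h1
    have h2 := congrArg (Vx d n) h1
    rw [hT'.Vx_Vx hd hdn, hT.Vx_Vx hd hdn] at h2
    exact h.ne h2.symm

lemma IsMultiplex.pdim_mface_le (hM : IsMultiplex d n P x) : ∀ (k : ℕ) (T : Finset ℤ),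
    SmallDiam d n T → T.card = k + 1 → pdim (mface d x T) + T.card ≤ d := by
  classical
  intro k
  have hd := hM.two_le_d
  induction k with
  | zero =>
    intro T hT hc
    obtain ⟨t, rfl⟩ := Finset.card_eq_one.1 hc
    have ht := Finset.mem_Icc.1 (hT.1 (Finset.mem_singleton_self t))
    have h : mface d x {t} = mfacet d x t := by simp [mface]
    rw [h, (hM.facet_face ht.1 ht.2).2, hc]
    omega
  | succ k ih =>
    intro T hT hc
    obtain ⟨t, ht⟩ := hT.2.1
    have hc' : (T.erase t).card = k + 1 := by
      rw [Finset.card_erase_of_mem ht]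
      omega
    have hs : SmallDiam d n (T.erase t) :=
      hT.mono (Finset.erase_subset _ _) (Finset.card_pos.1 (by omega))
    have h1 := ih _ hs hc'
    have h2 := hM.mface_lt hs hT (Finset.erase_ssubset ht)
    omega

lemma IsMultiplex.pdim_mface_ge (hM : IsMultiplex d n P x) {W : Finset ℤ}
    (hW : SmallDiam d n W) (hWd : d ≤ pdim (mface d x W) + W.card) : ∀ (k : ℕ) (T : Finset ℤ),
    SmallDiam d n T → T ⊆ W → W.card = T.card + k → d ≤ pdim (mface d x T) + T.card := by
  classical
  intro k
  induction k with
  | zero =>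
    intro T hT hTW hc
    have : T = W := Finset.eq_of_subset_of_card_le hTW (by omega)
    rwa [this]
  | succ k ih =>
    intro T hT hTW hc
    obtain ⟨w, hwW, hwT⟩ : ∃ w ∈ W, w ∉ T := by
      apply Finset.exists_mem_notMem_of_card_lt_card
      omega
    have hc' : (insert w T).card = T.card + 1 := Finset.card_insert_of_notMem hwT
    have hsub : insert w T ⊆ W := Finset.insert_subset hwW hTW
    have hs : SmallDiam d n (insert w T) := hW.mono hsub (Finset.insert_nonempty _ _)
    have h1 := ih _ hs hsub (by omega)
    have h2 := hM.mface_lt hT hs (Finset.ssubset_insert hwT)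
    omega

lemma IsMultiplex.pdim_mface (hM : IsMultiplex d n P x) {T : Finset ℤ}
    (hT : SmallDiam d n T) : pdim (mface d x T) + T.card = d := by
  have hd := hM.two_le_d
  have hdn := hM.d_le_n
  apply le_antisymm
  · have := Finset.card_pos.2 hT.2.1
    exact hM.pdim_mface_le (T.card - 1) T hT (by omega)
  · obtain ⟨W, hW, hTW, hWc, u, hu, v, hv, huv⟩ := hT.window hd hdn
    refine hM.pdim_mface_ge hW ?_ (W.card - T.card) T hT hTW ?_
    · have hpos : pdim (mface d x W) ≠ 0 := by
        intro h0
        have hface := hM.mface_face hW.1 hW.2.1 (hW.Vx_nonempty hd hdn)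
        rw [← hM.vs_mface hW.1, mem_vs] at hu hv
        rw [pdim_eq] at h0
        have hfin : FiniteDimensional ℝ (vectorSpan ℝ (mface d x W)) := by
          have := finiteDimensional_vectorSpan_hull (E := E)
            (IsMultiplex.finite_verts (n := n) (x := x))
          rw [← hM.hull] at this
          exact Submodule.finiteDimensional_of_le (vectorSpan_mono ℝ hface.1.subset)
        have hbot := Submodule.finrank_eq_zero.1 h0
        have hmem := vsub_mem_vectorSpan ℝ hu.2 hv.2
        rw [hbot, Submodule.mem_bot, vsub_eq_zero_iff_eq] at hmem
        exact huv (hM.inj hu.1 hv.1 hmem)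
      omega
    · have := Finset.card_le_card hTW
      omega

/-- The simplex face with vertex set `G`. -/
lemma IsMultiplex.simplex_face (hM : IsMultiplex d n P x) {G : Finset ℤ}
    (hG : SmallDiam d n G) :
    IsFaceOf P (mface d x (Vx d n G)) ∧ vs n x (mface d x (Vx d n G)) = G := by
  have hd := hM.two_le_d
  have hdn := hM.d_le_n
  have hVV := hG.Vx_Vx hd hdn
  refine ⟨hM.mface_face Vx_subset (hG.Vx_nonempty hd hdn) (by rw [hVV]; exact hG.2.1), ?_⟩
  rw [hM.vs_mface Vx_subset, hVV]

lemma IsMultiplex.pdim_simplex_ge (hM : IsMultiplex d n P x) : ∀ (k : ℕ) (G : Finset ℤ),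
    SmallDiam d n G → G.card = k + 1 → k ≤ pdim (mface d x (Vx d n G)) := by
  classical
  intro k
  induction k with
  | zero =>
    intro G hG hc
    exact Nat.zero_le _
  | succ k ih =>
    intro G hG hc
    obtain ⟨t, ht⟩ := hG.2.1
    have hc' : (G.erase t).card = k + 1 := by
      rw [Finset.card_erase_of_mem ht]
      omega
    have hs : SmallDiam d n (G.erase t) :=
      hG.mono (Finset.erase_subset _ _) (Finset.card_pos.1 (by omega))
    have h1 := ih _ hs hc'
    obtain ⟨f1, v1⟩ := hM.simplex_face hs
    obtain ⟨f2, v2⟩ := hM.simplex_face hG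
    have h2 := hM.pdim_lt f1 f2 (hM.face_subset f1 f2 (by rw [v1, v2]; exact Finset.erase_subset _ _))
      (fun heq => by
        have := congrArg (vs n x) heq
        rw [v1, v2] at this
        exact (Finset.erase_ssubset ht).ne this)
    omega

lemma IsMultiplex.pdim_simplex (hM : IsMultiplex d n P x) {G : Finset ℤ}
    (hG : SmallDiam d n G) : pdim (mface d x (Vx d n G)) + 1 = G.card := by
  classical
  have hpos := Finset.card_pos.2 hG.2.1
  obtain ⟨k, hk⟩ : ∃ k, G.card = k + 1 := ⟨G.card - 1, by omega⟩
  have h1 := hM.pdim_simplex_ge k G hG hk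
  obtain ⟨f1, v1⟩ := hM.simplex_face hG
  have h2 : pdim (mface d x (Vx d n G)) ≤ k := by
    rw [hM.face_hull f1, v1, pdim, affineSpan_convexHull, direction_affineSpan]
    have := finrank_vectorSpan_image_finset_le ℝ x G hk
    rwa [Finset.coe_image] at this
  omega

end Multiplex

/-- The number of `i`-dimensional faces of the multiplex `M^{d,n}` is
`C(d+1, i+1) + (n-d)·C(d-1, i)`. -/
theorem multiplex_face_count (d n i : ℕ) (hd : 2 ≤ d) (hdn : d ≤ n) (hi : i ≤ d - 1)
    (P : Set E) (x : ℤ → E) (hM : IsMultiplex d n P x) :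
    faceCount P i = (d + 1).choose (i + 1) + (n - d) * (d - 1).choose i := by
  rw [← count_formula hd hdn hi]
  have hset : {F : Set E | IsFaceOf P F ∧ pdim F = i} =
      (fun G => mface d x (Vx d n G)) '' (smallSets d n (i + 1) : Set (Finset ℤ)) ∪
      (fun T => mface d x T) '' (smallSets d n (d - i) : Set (Finset ℤ)) := by
    ext F
    constructor
    · rintro ⟨hF, hFi⟩
      have hV := hM.Vx_vs_nonempty hF (by omega)
      have hVV := hM.Vx_vs hF
      have hne := hM.vs_nonempty hF
      have hface : IsFaceOf P (mface d x (Vx d n (vs n x F))) :=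
        hM.mface_face Vx_subset hV (by rw [hVV]; exact hne)
      have hFeq : mface d x (Vx d n (vs n x F)) = F :=
        hM.face_ext hface hF (by rw [hM.vs_mface Vx_subset, hVV])
      rcases small_or_small hd hdn vs_subset hne hV with h | h
      · left
        refine ⟨vs n x F, ?_, hFeq⟩
        have := hM.pdim_simplex h
        rw [hFeq, hFi] at this
        exact (mem_smallSets (by omega)).2 ⟨h, this.symm⟩
      · right
        refine ⟨Vx d n (vs n x F), ?_, hFeq⟩
        have := hM.pdim_mface h
        rw [hFeq, hFi] at this
        exact (mem_smallSets (by omega)).2 ⟨h, by omega⟩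
    · rintro (⟨G, hG, rfl⟩ | ⟨T, hT, rfl⟩)
      · obtain ⟨h1, h2⟩ := (mem_smallSets (by omega)).1 (Finset.mem_coe.1 hG)
        have := hM.pdim_simplex h1
        exact ⟨(hM.simplex_face h1).1, by simp only; omega⟩
      · obtain ⟨h1, h2⟩ := (mem_smallSets (by omega)).1 (Finset.mem_coe.1 hT)
        have := hM.pdim_mface h1
        exact ⟨hM.mface_face h1.1 h1.2.1 (h1.Vx_nonempty hd hdn), by simp only; omega⟩
  unfold faceCount
  rw [hset, Set.ncard_union_eq, Set.InjOn.ncard_image, Set.InjOn.ncard_image,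
    Set.ncard_coe_finset, Set.ncard_coe_finset]
  · intro T hT T' hT' heq
    obtain ⟨h1, -⟩ := (mem_smallSets (by omega)).1 (Finset.mem_coe.1 hT)
    obtain ⟨h2, -⟩ := (mem_smallSets (by omega)).1 (Finset.mem_coe.1 hT')
    have h := congrArg (vs n x) heq
    simp only at h
    rw [hM.vs_mface h1.1, hM.vs_mface h2.1] at h
    rw [← h1.Vx_Vx hd hdn, ← h2.Vx_Vx hd hdn, h]
  · intro G hG G' hG' heq
    obtain ⟨h1, -⟩ := (mem_smallSets (by omega)).1 (Finset.mem_coe.1 hG)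
    obtain ⟨h2, -⟩ := (mem_smallSets (by omega)).1 (Finset.mem_coe.1 hG')
    have h := congrArg (vs n x) heq
    simp only at h
    rwa [(hM.simplex_face h1).2, (hM.simplex_face h2).2] at h
  · rw [Set.disjoint_left]
    rintro _ ⟨G, hG, rfl⟩ ⟨T, hT, heq⟩
    obtain ⟨h1, -⟩ := (mem_smallSets (by omega)).1 (Finset.mem_coe.1 hG)
    obtain ⟨h2, -⟩ := (mem_smallSets (by omega)).1 (Finset.mem_coe.1 hT)
    have h := congrArg (vs n x) heq
    simp only at h
    rw [(hM.simplex_face h1).2, hM.vs_mface h2.1] at h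
    exact h2.not_Vx hd hdn (h ▸ h1)
end

section
/- For S = {s_1 < s_2 < ... < s_r} ⊆ {0,1,...,d-1} with s_{r+1} := d, the flag number f_S of the multiplex M^{d,n} equals the multinomial coefficient (d+1)! / ((s_1+1)!·(s_2-s_1)!·...·(s_r-s_{r-1})!·(d-s_r)!) times [1 + (n-d)/((d+1)d(d-1)) · Σ_{j=1}^r (s_j+1)(s_{j+1}-s_j)(s_{j+1}-1)]. -/
open Set

variable {E : Type*} [NormedAddCommGroup E] [NormedSpace ℝ E]

/-- vertex set of the `i`-th facet -/
def Fset (d n i : ℕ) : Finset ℕ :=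
  (Finset.range (n + 1)).filter (fun j => j ≤ i + (d - 1) ∧ i ≤ j + (d - 1) ∧ (j ≠ i ∨ i = 0 ∨ i = n))

def sig (d n i p : ℕ) : ℕ :=
  if i = 0 ∨ i = n ∨ i - (d - 1) + p < i then i - (d - 1) + p else i - (d - 1) + p + 1

def nI (d n i : ℕ) : ℕ :=
  if i = 0 ∨ i = n then d - 1 else min i (d - 1) + min (n - i) (d - 1) - 1

def qI (d n i : ℕ) : ℕ := if i = n then d else min i (d - 1)

theorem mem_Fset {d n i j : ℕ} : j ∈ Fset d n i ↔ j ≤ n ∧ j ≤ i + (d - 1) ∧ i ≤ j + (d - 1) ∧ (j ≠ i ∨ i = 0 ∨ i = n) := by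
  simp [Fset]

theorem sig_inj (d n i : ℕ) : Function.Injective (sig d n i) := by
  intro p q h
  unfold sig at h
  split_ifs at h <;> omega

theorem image_sig {d n i : ℕ} (hd : 2 ≤ d) (hn : d ≤ n) (hi : i ≤ n) :
    (Finset.range (nI d n i + 1)).image (sig d n i) = Fset d n i := by
  ext j
  simp only [Finset.mem_image, Finset.mem_range, mem_Fset]
  constructor
  · rintro ⟨p, hp, rfl⟩
    unfold nI at hp
    unfold sig
    split_ifs at hp ⊢ <;> omega
  · rintro ⟨h1, h2, h3, h4⟩
    by_cases h : i = 0 ∨ i = n ∨ j < i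
    · refine ⟨j - (i - (d - 1)), ?_, ?_⟩
      · unfold nI; split_ifs <;> omega
      · unfold sig; split_ifs <;> omega
    · refine ⟨j - (i - (d - 1)) - 1, ?_, ?_⟩
      · unfold nI; split_ifs <;> omega
      · unfold sig; split_ifs <;> omega

theorem nI_ge {d n i : ℕ} (hd : 2 ≤ d) (hn : d ≤ n) (hi : i ≤ n) : d - 1 ≤ nI d n i := by
  unfold nI; split_ifs <;> omega

theorem nI_one {d n i : ℕ} (hd : d = 2) (hn : d ≤ n) (hi : i ≤ n) : nI d n i = 1 := by
  unfold nI; split_ifs <;> omega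

theorem Fset_antichain {d n p q : ℕ} (hd : 1 ≤ d) (hn : d ≤ n) (h1 : d = 1 → n = 1)
    (hp : p ≤ n) (hq : q ≤ n) (h : Fset d n p ⊆ Fset d n q) : p = q := by
  have H : ∀ j, j ∈ Fset d n p → j ∈ Fset d n q := fun j hj => h hj
  simp only [mem_Fset] at H
  have a1 := H 0
  have a2 := H n
  have a3 := H q
  have a4 := H (p + (d-1))
  have a5 := H (p - (d-1))
  omega

theorem Fset_ssubset {d n p : ℕ} (hd : 1 ≤ d) (hn : d ≤ n) (hp : p ≤ n) :
    Fset d n p ⊂ Finset.range (n + 1) := by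
  refine (Finset.filter_subset _ _).ssubset_of_ne ?_
  intro h
  have H : ∀ j, j ∈ Finset.range (n + 1) → j ∈ Fset d n p := fun j hj => by rw [Fset, h]; exact hj
  simp only [mem_Fset, Finset.mem_range] at H
  have a1 := H 0
  have a2 := H n
  have a3 := H p
  omega

theorem Fset_nonempty {d n p : ℕ} (hd : 1 ≤ d) (hn : d ≤ n)  (h1 : d = 1 → n = 1)
    (hp : p ≤ n) : (Fset d n p).Nonempty := by
  by_cases h : p = 0 ∨ p = n
  · exact ⟨p, by rw [mem_Fset]; omega⟩
  · exact ⟨p - 1, by rw [mem_Fset]; omega⟩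

theorem L1a {d n i j : ℕ} (hd : 2 ≤ d) (hn : d ≤ n) (hi : i ≤ n) (hj : j ≤ n) (hij : j ≠ i) :
    ∃ p ≤ nI d n i, (j < i → p < qI d n i) ∧
      ∀ t ≤ nI d n i, sig d n i t ∈ Fset d n j → t ∈ Fset (d - 1) (nI d n i) p := by
  by_cases h0 : i = 0
  · have e1 : nI d n i = d - 1 := by simp [nI, h0]
    have e2 : ∀ t, sig d n i t = t := by intro t; simp [sig, h0]
    refine ⟨if j + 2 ≤ d then j else if j = d - 1 then 0 else d - 1, ?_, ?_, ?_⟩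
    · rw [e1]; split_ifs <;> omega
    · omega
    · intro t ht
      simp only [e1, e2, mem_Fset] at ht ⊢
      split_ifs <;> omega
  by_cases h1 : i = n
  · have e1 : nI d n i = d - 1 := by simp [nI, h1]
    have e2 : ∀ t, sig d n i t = n - (d - 1) + t := by intro t; simp [sig, h1]
    have e3 : qI d n i = d := by simp [qI, h1]
    refine ⟨if j = n - (d - 1) then d - 1 else j - (n - (d-1)), ?_, ?_, ?_⟩
    · rw [e1]; split_ifs <;> omega
    · rw [e3]; split_ifs <;> omega
    · intro t ht
      simp only [e1, e2, mem_Fset] at ht ⊢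
      split_ifs <;> omega
  have e1 : nI d n i = min i (d - 1) + min (n - i) (d - 1) - 1 := by simp [nI, h0, h1]
  have e3 : qI d n i = min i (d - 1) := by simp [qI, h1]
  refine ⟨if j < i then j - (i - (d - 1)) else min (j - (i - (d - 1)) - 1) (nI d n i), ?_, ?_, ?_⟩
  · rw [e1]; split_ifs <;> omega
  · rw [e3]; split_ifs <;> omega
  · intro t ht
    simp only [e1, sig, mem_Fset] at ht ⊢
    split_ifs <;> omega

theorem L2a {d n i p : ℕ} (hd : 2 ≤ d) (hn : d ≤ n) (hi : i ≤ n) (hp : p ≤ nI d n i) :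
    ∃ j ≤ n, j ≠ i ∧ (p < qI d n i → j < i) ∧
      ∀ t ≤ nI d n i, (sig d n i t ∈ Fset d n j ↔ t ∈ Fset (d - 1) (nI d n i) p) := by
  by_cases h0 : i = 0
  · have e1 : nI d n i = d - 1 := by simp [nI, h0]
    have e2 : ∀ t, sig d n i t = t := by intro t; simp [sig, h0]
    have e3 : qI d n i = 0 := by simp [qI, h0]; omega
    rw [e1] at hp
    refine ⟨if p = 0 then d - 1 else if p = d - 1 then d else p, ?_, ?_, ?_, ?_⟩
    · split_ifs <;> omega
    · split_ifs <;> omega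
    · omega
    · intro t ht
      simp only [e1, e2, mem_Fset] at ht ⊢
      split_ifs <;> omega
  by_cases h1 : i = n
  · have e1 : nI d n i = d - 1 := by simp [nI, h1]
    have e2 : ∀ t, sig d n i t = n - (d - 1) + t := by intro t; simp [sig, h1]
    have e3 : qI d n i = d := by simp [qI, h1]
    rw [e1] at hp
    refine ⟨if p = d - 1 then n - (d - 1) else if p = 0 then n - d else n - (d - 1) + p, ?_, ?_, ?_, ?_⟩
    · split_ifs <;> omega
    · split_ifs <;> omega
    · split_ifs <;> omega
    · intro t ht
      simp only [e1, e2, mem_Fset] at ht ⊢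
      split_ifs <;> omega
  have e1 : nI d n i = min i (d - 1) + min (n - i) (d - 1) - 1 := by simp [nI, h0, h1]
  have e3 : qI d n i = min i (d - 1) := by simp [qI, h1]
  rw [e1] at hp
  refine ⟨if p = 0 then i - (d - 1) - 1 else if p < min i (d - 1) then i - (d - 1) + p else
     if p < nI d n i then i - (d - 1) + p + 1 else min (i + d) n, ?_, ?_, ?_, ?_⟩
  · rw [e1]; split_ifs <;> omega
  · rw [e1]; split_ifs <;> omega
  · rw [e1, e3]; split_ifs <;> omega
  · intro t ht
    have e4 : sig d n i t = if i - (d - 1) + t < i then i - (d - 1) + t else i - (d - 1) + t + 1 := by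
      simp [sig, h0, h1]
    rw [e4]
    clear e4 e3
    generalize nI d n i = N at *
    simp only [mem_Fset]
    obtain ⟨e, rfl⟩ : ∃ e, d = e + 1 := ⟨d - 1, by omega⟩
    obtain ⟨c, rfl⟩ : ∃ c, n = i + c := ⟨n - i, by omega⟩
    simp only [Nat.add_sub_cancel, Nat.add_sub_cancel_left] at *
    have hL : (i ≤ e ∧ i - e = 0 ∧ min i e = i) ∨ (e ≤ i ∧ i = (i - e) + e ∧ min i e = e) := by omega
    have hR : (c ≤ e ∧ min c e = c) ∨ (e ≤ c ∧ min c e = e) := by omega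
    generalize i - e = L at *
    generalize min i e = a at *
    generalize min c e = b at *
    rcases hL with ⟨g1, g2, g3⟩ | ⟨g1, g2, g3⟩ <;> rcases hR with ⟨g4, g5⟩ | ⟨g4, g5⟩ <;>
      by_cases h5 : L + t < i <;> simp only [h5, if_true, if_false] <;>
      split_ifs <;> (try simp only [false_or]) <;> omega


structure FaceSys (Fa : Finset ℕ → Prop) (dm : Finset ℕ → ℕ) : Prop where
  ne : ∀ A, Fa A → A.Nonempty
  mono : ∀ A B, Fa A → Fa B → A ⊂ B → dm A < dm B
  inter : ∀ A B, Fa A → Fa B → (A ∩ B).Nonempty → Fa (A ∩ B)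
  facet : ∀ A B, Fa A → Fa B → A ⊂ B → ∃ C, Fa C ∧ A ⊆ C ∧ C ⊂ B ∧ dm C + 1 = dm B
  two : ∀ A C B, Fa A → Fa C → Fa B → A ⊂ C → C ⊂ B → ∃ D, Fa D ∧ A ⊆ D ∧ D ⊂ B ∧ ¬ D ⊆ C

structure Mux (Fa : Finset ℕ → Prop) (dm : Finset ℕ → ℕ) (d n : ℕ) (z : ℕ → ℕ) : Prop where
  d1 : 1 ≤ d
  dn : d ≤ n
  one : d = 1 → n = 1
  inj : Function.Injective z
  face : Fa ((Finset.range (n + 1)).image z)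
  dim : dm ((Finset.range (n + 1)).image z) = d
  facets : ∀ C, (Fa C ∧ C ⊆ (Finset.range (n + 1)).image z ∧ dm C + 1 = d) ↔
    ∃ i ≤ n, C = (Fset d n i).image z

theorem image_sub {z : ℕ → ℕ} (hz : Function.Injective z) {A B : Finset ℕ} :
    A.image z ⊆ B.image z ↔ A ⊆ B := Finset.image_subset_image_iff hz

theorem Mux.step {Fa : Finset ℕ → Prop} {dm : Finset ℕ → ℕ} (hF : FaceSys Fa dm) {d n : ℕ} {z : ℕ → ℕ}
    (hM : Mux Fa dm d n z) (hd : 2 ≤ d) {i : ℕ} (hi : i ≤ n) :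
    Mux Fa dm (d - 1) (nI d n i) (z ∘ sig d n i) := by
  have hn := hM.dn
  have him : (Finset.range (nI d n i + 1)).image (z ∘ sig d n i) = (Fset d n i).image z := by
    rw [← Finset.image_image, image_sig hd hn hi]
  obtain ⟨fB, sB, dB⟩ := (hM.facets _).2 ⟨i, hi, rfl⟩
  have ssB : (Fset d n i).image z ⊂ (Finset.range (n + 1)).image z := by
    refine sB.ssubset_of_ne ?_
    intro h
    rw [h, hM.dim] at dB
    omega
  have hinj : Function.Injective (z ∘ sig d n i) := hM.inj.comp (sig_inj d n i)
  -- the ridges are faces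
  have Gsub : ∀ p, (Fset (d - 1) (nI d n i) p).image (z ∘ sig d n i) ⊆ (Fset d n i).image z := by
    intro p
    rw [← him]
    exact Finset.image_subset_image (Finset.filter_subset _ _)
  have h1' : d - 1 = 1 → nI d n i = 1 := fun h => nI_one (by omega) hn hi
  have Gface : ∀ p ≤ nI d n i, Fa ((Fset (d - 1) (nI d n i) p).image (z ∘ sig d n i)) := by
    intro p hp
    obtain ⟨j, hj, hji, -, hjt⟩ := L2a hd hn hi hp
    have : (Fset (d - 1) (nI d n i) p).image (z ∘ sig d n i)
        = (Fset d n i).image z ∩ (Fset d n j).image z := by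
      ext v
      rw [← him]
      simp only [Finset.mem_inter, Finset.mem_image, Finset.mem_range, Function.comp]
      constructor
      · rintro ⟨t, ht, rfl⟩
        have := (mem_Fset.1 ht).1
        exact ⟨⟨t, by omega, rfl⟩, ⟨_, (hjt t this).2 ht, rfl⟩⟩
      · rintro ⟨⟨t, ht, rfl⟩, ⟨u, hu, h⟩⟩
        have := hM.inj h
        subst this
        exact ⟨t, (hjt t (by omega)).1 hu, rfl⟩
    have hne := (Fset_nonempty (d := d - 1) (by omega) (nI_ge hd hn hi) h1' hp).image (z ∘ sig d n i)
    rw [this] at hne ⊢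
    exact hF.inter _ _ fB ((hM.facets _).2 ⟨j, hj, rfl⟩).1 hne
  have Gss : ∀ p ≤ nI d n i, (Fset (d - 1) (nI d n i) p).image (z ∘ sig d n i) ⊂ (Fset d n i).image z := by
    intro p hp
    rw [← him]
    exact (Finset.image_ssubset_image hinj).2 (Fset_ssubset (by omega) (nI_ge hd hn hi) hp)
  have fwd : ∀ C, Fa C → C ⊆ (Fset d n i).image z → dm C + 1 = d - 1 →
      ∃ p ≤ nI d n i, C = (Fset (d - 1) (nI d n i) p).image (z ∘ sig d n i) := by
    intro C fC sC dC
    have ssC : C ⊂ (Fset d n i).image z := by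
      refine sC.ssubset_of_ne ?_
      rintro rfl
      omega
    obtain ⟨D, fD, CD, DB, nD⟩ := hF.two _ _ _ fC fB hM.face ssC ssB
    obtain ⟨F, fF, DF, FB, dF⟩ := hF.facet _ _ fD hM.face DB
    rw [hM.dim] at dF
    obtain ⟨j, hj, rfl⟩ := (hM.facets F).1 ⟨fF, FB.subset, dF⟩
    have hji : j ≠ i := by
      rintro rfl
      exact nD DF
    obtain ⟨p, hp, -, hpt⟩ := L1a hd hn hi hj hji
    have CG : C ⊆ (Fset (d - 1) (nI d n i) p).image (z ∘ sig d n i) := by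
      intro v hv
      have h1 := sC hv
      have h2 := DF (CD hv)
      rw [← him] at h1
      simp only [Finset.mem_image, Finset.mem_range, Function.comp] at h1 h2 ⊢
      obtain ⟨t, ht, rfl⟩ := h1
      obtain ⟨u, hu, h⟩ := h2
      have := hM.inj h
      subst this
      exact ⟨t, hpt t (by omega) hu, rfl⟩
    refine ⟨p, hp, ?_⟩
    by_contra hne
    have a1 := hF.mono _ _ fC (Gface p hp) (CG.ssubset_of_ne hne)
    have a2 := hF.mono _ _ (Gface p hp) fB (Gss p hp)
    omega
  refine ⟨by omega, nI_ge hd hn hi, h1', hinj, ?_, ?_, ?_⟩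
  · rw [him]; exact fB
  · rw [him]; omega
  · intro C
    rw [him]
    constructor
    · rintro ⟨a, b, c⟩
      exact fwd C a b c
    · rintro ⟨p, hp, rfl⟩
      refine ⟨Gface p hp, Gsub p, ?_⟩
      obtain ⟨C, fC, GC, CB, dC⟩ := hF.facet _ _ (Gface p hp) fB (Gss p hp)
      obtain ⟨p', hp', rfl⟩ := fwd C fC CB.subset (by omega)
      have := Fset_antichain (by omega) (nI_ge hd hn hi) h1' hp hp' ((image_sub hinj).1 GC)
      subst this
      omega

theorem Mux.sub_facet {Fa : Finset ℕ → Prop} {dm : Finset ℕ → ℕ} (hF : FaceSys Fa dm) {d n : ℕ} {z : ℕ → ℕ}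
    (hM : Mux Fa dm d n z) {A : Finset ℕ} (fA : Fa A) (sA : A ⊂ (Finset.range (n + 1)).image z) :
    ∃ i ≤ n, A ⊆ (Fset d n i).image z := by
  obtain ⟨F, fF, DF, FB, dF⟩ := hF.facet _ _ fA hM.face sA
  rw [hM.dim] at dF
  obtain ⟨j, hj, rfl⟩ := (hM.facets F).1 ⟨fF, FB.subset, dF⟩
  exact ⟨j, hj, DF⟩

theorem Mux.good {Fa : Finset ℕ → Prop} {dm : Finset ℕ → ℕ} (hF : FaceSys Fa dm) (d : ℕ) :
    ∀ (n : ℕ) (z : ℕ → ℕ), Mux Fa dm d n z → ∀ A, Fa A → A ⊆ (Finset.range (n + 1)).image z →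
    dm A = 0 ∨ ∃ m w, Mux Fa dm (dm A) m w ∧ A = (Finset.range (m + 1)).image w := by
  induction d using Nat.strong_induction_on with
  | _ d ih =>
  intro n z hM A fA sA
  by_cases h : A = (Finset.range (n + 1)).image z
  · right
    refine ⟨n, z, ?_, h⟩
    rw [h, hM.dim]
    exact hM
  have ss := sA.ssubset_of_ne h
  have hlt := hF.mono _ _ fA hM.face ss
  rw [hM.dim] at hlt
  by_cases hd : 2 ≤ d
  · obtain ⟨i, hi, hA⟩ := hM.sub_facet hF fA ss
    have := ih (d - 1) (by omega) _ _ (hM.step hF hd hi) A fA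
    rw [← Finset.image_image, image_sig hd hM.dn hi] at this
    exact this hA
  · left; omega


theorem hockey (m c : ℕ) (hc : 1 ≤ c ∨ m = 0) (b : ℕ) :
    ∑ u ∈ Finset.range b, (u - m).choose c = (b - m).choose (c + 1) := by
  induction b with
  | zero => simp
  | succ b ih =>
    rw [Finset.sum_range_succ, ih]
    by_cases h : m ≤ b
    · rw [Nat.succ_sub h, Nat.choose_succ_succ', add_comm]
    · rw [show b - m = 0 by omega, show b + 1 - m = 0 by omega]
      rw [Nat.choose_eq_zero_of_lt (by omega : 0 < c)]; omega

theorem minsum (f : ℕ → ℕ) (d n : ℕ) (hd : 1 ≤ d) (hn : d ≤ n) :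
    ∑ u ∈ Finset.range n, f (min u (d - 1)) = ∑ u ∈ Finset.range d, f u + (n - d) * f (d - 1) := by
  induction n, hn using Nat.le_induction with
  | base =>
    simp
    refine Finset.sum_congr rfl fun u hu => ?_
    rw [Finset.mem_range] at hu
    rw [min_eq_left (by omega)]
  | succ n hn ih =>
    rw [Finset.sum_range_succ, ih, min_eq_right (by omega), Nat.succ_sub hn, Nat.succ_mul]; ring

def Hf (α β : ℚ) (d n k i : ℕ) : ℚ :=
  if i = 0 then α * (d.choose (d - 1 - k) : ℕ) else
    α * ((min (n - i) (d - 1)).choose (d - 1 - k) : ℕ) +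
    β * (((min (n - i) (d - 1) - 1).choose (d - k) : ℕ) - ((d - 1 - min i (d - 1)).choose (d - k) : ℕ))

theorem Hf_total (α β : ℚ) (d n k : ℕ) (hd : 1 ≤ d) (hn : d ≤ n) (h1 : d = 1 → n = 1) (hk : k < d) :
    ∑ i ∈ Finset.range (n + 1), Hf α β d n k i =
      α * ((d + 1).choose (k + 1) + ((n : ℚ) - d) * (d - 1).choose k) +
      β * (((n : ℚ) - d) * (d - 2).choose (d - k)) := by
  rw [Finset.sum_range_succ']
  have e0 : Hf α β d n k 0 = α * (d.choose (d - 1 - k) : ℕ) := by simp [Hf]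
  have e1 : ∀ i, Hf α β d n k (i + 1) = α * ((min (n - 1 - i) (d - 1)).choose (d - 1 - k) : ℕ) +
    β * (((min (n - 1 - i) (d - 1) - 1).choose (d - k) : ℕ) - ((d - 1 - (i + 1)).choose (d - k) : ℕ)) := by
    intro i
    simp only [Hf, Nat.add_eq_zero_iff, one_ne_zero, and_false, if_false]
    rw [show n - (i + 1) = n - 1 - i by omega, show d - 1 - min (i + 1) (d - 1) = d - 1 - (i + 1) by omega]
  simp only [e0, e1]
  rw [Finset.sum_add_distrib, ← Finset.mul_sum, ← Finset.mul_sum, Finset.sum_sub_distrib,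
    ← Nat.cast_sum, ← Nat.cast_sum, ← Nat.cast_sum]
  rw [Finset.sum_range_reflect (fun u => (min u (d - 1)).choose (d - 1 - k)) n,
    Finset.sum_range_reflect (fun u => (min u (d - 1) - 1).choose (d - k)) n]
  rw [minsum (fun u => u.choose (d - 1 - k)) d n hd hn, minsum (fun u => (u - 1).choose (d - k)) d n hd hn]
  have a1 := hockey 0 (d - 1 - k) (by omega) d
  have a2 := hockey 1 (d - k) (by omega) d
  have a3 : ∑ i ∈ Finset.range n, (d - 1 - (i + 1)).choose (d - k) = (d - 1).choose (d - k + 1) := by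
    rw [← a2, ← Finset.sum_range_reflect _ d]
    obtain ⟨m, rfl⟩ := Nat.exists_eq_add_of_le hn
    rw [Finset.sum_range_add]
    have : ∑ x ∈ Finset.range m, (d - 1 - (d + x + 1)).choose (d - k) = 0 := by
      refine Finset.sum_eq_zero fun x _ => Nat.choose_eq_zero_of_lt (by omega)
    rw [this, add_zero]
    refine Finset.sum_congr rfl fun x _ => ?_
    congr 1
  simp only [Nat.sub_zero] at a1
  rw [a1, a2, a3]
  have b1 : (d - 1).choose (d - 1 - k) = (d - 1).choose k := Nat.choose_symm (by omega)
  have b2 : (d + 1).choose (k + 1) = d.choose (d - 1 - k) + d.choose (d - 1 - k + 1) := by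
    rw [← Nat.choose_succ_succ, ← Nat.choose_symm (by omega : k + 1 ≤ d + 1)]
    congr 1; omega
  rw [b1, b2, show d - 1 - 1 = d - 2 by omega]
  push_cast [Nat.cast_sub hn]
  ring

theorem Hf_rec (α β : ℚ) (d n k i : ℕ) (hd : 2 ≤ d) (hn : d ≤ n) (hi : i ≤ n) (hk : k + 1 < d) :
    ∑ p ∈ Finset.Ico (qI d n i) (nI d n i + 1), Hf α β (d - 1) (nI d n i) k p = Hf α β d n k i := by
  by_cases h1 : i = n
  · have e1 : nI d n i = d - 1 := by simp [nI, h1]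
    have e3 : qI d n i = d := by simp [qI, h1]
    rw [e1, e3, show d - 1 + 1 = d by omega, Finset.Ico_self, Finset.sum_empty, Hf, if_neg (by omega), h1]
    simp only [Nat.sub_self, Nat.zero_min]
    rw [Nat.choose_eq_zero_of_lt (by omega), Nat.choose_eq_zero_of_lt (by omega), Nat.choose_eq_zero_of_lt (by omega)]
    simp
  by_cases h0 : i = 0
  · have e1 : nI d n i = d - 1 := by simp [nI, h0]
    have e3 : qI d n i = 0 := by simp [qI, h0]; omega
    rw [e1, e3, ← Finset.range_eq_Ico, Hf_total _ _ _ _ _ (by omega) le_rfl (by omega) (by omega)]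
    simp only [Hf, h0, if_true, sub_self, zero_mul, mul_zero, add_zero]
    rw [show d - 1 + 1 = d by omega, ← Nat.choose_symm (by omega : k + 1 ≤ d)]
    congr 3; omega
  have e1 : nI d n i = min i (d - 1) + min (n - i) (d - 1) - 1 := by simp [nI, h0, h1]
  have e3 : qI d n i = min i (d - 1) := by simp [qI, h1]
  have e5 : nI d n i + 1 = min i (d - 1) + min (n - i) (d - 1) := by omega
  rw [Hf, if_neg h0, e5, e3]
  have ha : 1 ≤ min i (d - 1) ∧ min i (d - 1) ≤ d - 1 := by omega
  have hb : 1 ≤ min (n - i) (d - 1) ∧ min (n - i) (d - 1) ≤ d - 1 := by omega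
  have hab : d ≤ min i (d - 1) + min (n - i) (d - 1) := by omega
  rw [e1]
  generalize min i (d - 1) = a at *
  generalize min (n - i) (d - 1) = b at *
  rw [Finset.sum_Ico_eq_sum_range, Nat.add_sub_cancel_left, ← Finset.sum_range_reflect]
  have key : ∀ u ∈ Finset.range b, Hf α β (d - 1) (a + b - 1) k (a + (b - 1 - u)) =
      α * (u.choose (d - 2 - k) : ℕ) + β * (((u - 1).choose (d - 1 - k) : ℕ) - ((u - (a + b + 1 - d)).choose (d - 1 - k) : ℕ)) := by
    intro u hu
    rw [Finset.mem_range] at hu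
    rw [Hf, if_neg (by omega)]
    rw [show min (a + b - 1 - (a + (b - 1 - u))) (d - 1 - 1) = u by omega]
    rw [show d - 1 - 1 - min (a + (b - 1 - u)) (d - 1 - 1) = u - (a + b + 1 - d) by omega]
    rfl
  rw [Finset.sum_congr rfl key]
  rw [Finset.sum_add_distrib, ← Finset.mul_sum, ← Finset.mul_sum, Finset.sum_sub_distrib,
    ← Nat.cast_sum, ← Nat.cast_sum, ← Nat.cast_sum]
  have h := hockey 0 (d - 2 - k) (by omega) b
  simp only [Nat.sub_zero] at h
  rw [h, hockey 1 (d - 1 - k) (by omega) b, hockey (a + b + 1 - d) (d - 1 - k) (by omega) b]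
  rw [show d - 2 - k + 1 = d - 1 - k by omega, show d - 1 - k + 1 = d - k by omega,
    show b - (a + b + 1 - d) = d - 1 - a by omega]

theorem card_Fset {d n i : ℕ} (hd : 1 ≤ d) (hn : d ≤ n) (h1 : d = 1 → n = 1) (hi : i ≤ n) :
    (Fset d n i).card = nI d n i + 1 := by
  by_cases h : 2 ≤ d
  · rw [← image_sig h hn hi, Finset.card_image_of_injective _ (sig_inj d n i), Finset.card_range]
  · obtain rfl : d = 1 := by omega
    obtain rfl := h1 rfl
    interval_cases i <;> decide

open Classical in
noncomputable def mfaces (Fa : Finset ℕ → Prop) (dm : Finset ℕ → ℕ) (k : ℕ) (B : Finset ℕ) :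
    Finset (Finset ℕ) := B.powerset.filter (fun A => Fa A ∧ dm A = k)

theorem mem_mfaces {Fa : Finset ℕ → Prop} {dm : Finset ℕ → ℕ} {k : ℕ} {B A : Finset ℕ} :
    A ∈ mfaces Fa dm k B ↔ A ⊆ B ∧ Fa A ∧ dm A = k := by
  simp [mfaces]

open Classical in
noncomputable def cell (Fa : Finset ℕ → Prop) (dm : Finset ℕ → ℕ) (d n : ℕ) (z : ℕ → ℕ) (k i : ℕ) :
    Finset (Finset ℕ) :=
  (mfaces Fa dm k ((Fset d n i).image z)).filter (fun A => ∀ i' < i, ¬ A ⊆ (Fset d n i').image z)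

theorem mem_cell {Fa : Finset ℕ → Prop} {dm : Finset ℕ → ℕ} {d n : ℕ} {z : ℕ → ℕ} {k i : ℕ} {A : Finset ℕ} :
    A ∈ cell Fa dm d n z k i ↔ (A ⊆ (Fset d n i).image z ∧ Fa A ∧ dm A = k) ∧
      ∀ i' < i, ¬ A ⊆ (Fset d n i').image z := by
  simp [cell, mem_mfaces]

theorem cell_disj {Fa : Finset ℕ → Prop} {dm : Finset ℕ → ℕ} {d n : ℕ} {z : ℕ → ℕ} {k : ℕ} (s : Set ℕ) :
    s.PairwiseDisjoint (cell Fa dm d n z k) := by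
  intro i _ j _ hij
  rw [Function.onFun, Finset.disjoint_left]
  intro A h1 h2
  rw [mem_cell] at h1 h2
  rcases lt_or_gt_of_ne hij with h | h
  · exact h2.2 i h h1.1.1
  · exact h1.2 j h h2.1.1

theorem exists_cell {Fa : Finset ℕ → Prop} {dm : Finset ℕ → ℕ} {d n : ℕ} {z : ℕ → ℕ} {k : ℕ} {A : Finset ℕ}
    (fA : Fa A) (dA : dm A = k) (h : ∃ i ≤ n, A ⊆ (Fset d n i).image z) :
    ∃ i ≤ n, A ∈ cell Fa dm d n z k i := by
  classical
  refine ⟨Nat.find h, (Nat.find_spec h).1, ?_⟩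
  rw [mem_cell]
  refine ⟨⟨(Nat.find_spec h).2, fA, dA⟩, ?_⟩
  intro i' hi' hA
  exact Nat.find_min h hi' ⟨by have := (Nat.find_spec h).1; omega, hA⟩

theorem cell_sum {Fa : Finset ℕ → Prop} {dm : Finset ℕ → ℕ} (hF : FaceSys Fa dm) (α β : ℚ) (k : ℕ) (d : ℕ) :
    ∀ (n : ℕ) (z : ℕ → ℕ), Mux Fa dm d n z → k < d → ∀ i ≤ n,
    ∑ A ∈ cell Fa dm d n z k i, (α + β * ((A.card : ℚ) - 1 - k)) = Hf α β d n k i := by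
  induction d using Nat.strong_induction_on with
  | _ d ih =>
  intro n z hM hk i hi
  have hn := hM.dn
  obtain ⟨fB, sB, dB⟩ := (hM.facets _).2 ⟨i, hi, rfl⟩
  by_cases hk' : k + 1 = d
  · have : cell Fa dm d n z k i = {(Fset d n i).image z} := by
      ext A
      rw [mem_cell, Finset.mem_singleton]
      constructor
      · rintro ⟨⟨h1, h2, h3⟩, -⟩
        by_contra hne
        have := hF.mono _ _ h2 fB (h1.ssubset_of_ne hne)
        omega
      · rintro rfl
        refine ⟨⟨subset_rfl, fB, by omega⟩, ?_⟩
        intro i' hi' h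
        have := Fset_antichain hM.d1 hn hM.one hi (by omega) ((image_sub hM.inj).1 h)
        omega
    rw [this, Finset.sum_singleton, Finset.card_image_of_injective _ hM.inj, card_Fset hM.d1 hn hM.one hi]
    obtain rfl : d = k + 1 := hk'.symm
    simp only [Hf, nI, Nat.add_sub_cancel, Nat.sub_self, Nat.choose_zero_right, Nat.add_sub_cancel_left, Nat.choose_one_right]
    by_cases h0 : i = 0
    · simp [h0]
    by_cases h1 : i = n
    · simp [h1, min_eq_right (by omega : k ≤ n)]
    · have e1 := hM.one
      simp only [h0, h1, if_false, or_self]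
      have : (min i k + min (n - i) k - 1) + (k - min i k) = min (n - i) k - 1 + k := by omega
      have := congrArg (Nat.cast : ℕ → ℚ) this
      push_cast at this ⊢
      linear_combination β * this
  · have hd : 2 ≤ d := by omega
    have hS := hM.step hF hd hi
    have him : (Finset.range (nI d n i + 1)).image (z ∘ sig d n i) = (Fset d n i).image z := by
      rw [← Finset.image_image, image_sig hd hn hi]
    have hun : cell Fa dm d n z k i = (Finset.Ico (qI d n i) (nI d n i + 1)).biUnion
        (cell Fa dm (d - 1) (nI d n i) (z ∘ sig d n i) k) := by
      ext A
      simp only [Finset.mem_biUnion, Finset.mem_Ico]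
      constructor
      · intro hA
        rw [mem_cell] at hA
        obtain ⟨⟨h1, h2, h3⟩, h4⟩ := hA
        have ss : A ⊂ (Finset.range (nI d n i + 1)).image (z ∘ sig d n i) := by
          rw [him]
          refine h1.ssubset_of_ne ?_
          rintro rfl
          omega
        obtain ⟨p, hp, hA⟩ := exists_cell h2 h3 (hS.sub_facet hF h2 ss)
        refine ⟨p, ⟨?_, by omega⟩, hA⟩
        by_contra hlt
        obtain ⟨j, hj, hji, hjl, hjt⟩ := L2a hd hn hi hp
        refine h4 j (hjl (by omega)) ?_
        intro v hv
        have := (mem_cell.1 hA).1.1 hv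
        simp only [Finset.mem_image, Function.comp] at this ⊢
        obtain ⟨t, ht, rfl⟩ := this
        exact ⟨_, (hjt t (mem_Fset.1 ht).1).2 ht, rfl⟩
      · rintro ⟨p, ⟨hq, hp⟩, hA⟩
        rw [mem_cell] at hA ⊢
        obtain ⟨⟨h1, h2, h3⟩, h4⟩ := hA
        have sA : A ⊆ (Fset d n i).image z := by
          rw [← him]
          exact h1.trans (Finset.image_subset_image (Finset.filter_subset _ _))
        refine ⟨⟨sA, h2, h3⟩, ?_⟩
        intro j hj hAj
        obtain ⟨p', hp', hq', hpt⟩ := L1a hd hn hi (by omega : j ≤ n) (by omega)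
        refine h4 p' (by have := hq' hj; omega) ?_
        intro v hv
        have g1 := sA hv
        have g2 := hAj hv
        rw [← him] at g1
        simp only [Finset.mem_image, Finset.mem_range, Function.comp] at g1 g2 ⊢
        obtain ⟨t, ht, rfl⟩ := g1
        obtain ⟨u, hu, h⟩ := g2
        have := hM.inj h
        subst this
        exact ⟨t, hpt t (by omega) hu, rfl⟩
    rw [hun, Finset.sum_biUnion (cell_disj _), ← Hf_rec α β d n k i hd hn hi (by omega)]
    refine Finset.sum_congr rfl fun p hp => ?_
    rw [Finset.mem_Ico] at hp
    exact ih (d - 1) (by omega) _ _ hS (by omega) p (by omega)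

theorem face_sum {Fa : Finset ℕ → Prop} {dm : Finset ℕ → ℕ} (hF : FaceSys Fa dm) (α β : ℚ) {k d n : ℕ}
    {z : ℕ → ℕ} (hM : Mux Fa dm d n z) (hk : k < d) :
    ∑ A ∈ mfaces Fa dm k ((Finset.range (n + 1)).image z), (α + β * ((A.card : ℚ) - 1 - k)) =
      α * ((d + 1).choose (k + 1) + ((n : ℚ) - d) * (d - 1).choose k) +
      β * (((n : ℚ) - d) * (d - 2).choose (d - k)) := by
  rw [← Hf_total α β d n k hM.d1 hM.dn hM.one hk]
  have hun : mfaces Fa dm k ((Finset.range (n + 1)).image z) = (Finset.range (n + 1)).biUnion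
        (cell Fa dm d n z k) := by
    ext A
    simp only [Finset.mem_biUnion, Finset.mem_range, mem_mfaces]
    constructor
    · rintro ⟨h1, h2, h3⟩
      have ss : A ⊂ (Finset.range (n + 1)).image z := by
        refine h1.ssubset_of_ne ?_
        rintro rfl
        rw [hM.dim] at h3
        omega
      obtain ⟨p, hp, hA⟩ := exists_cell h2 h3 (hM.sub_facet hF h2 ss)
      exact ⟨p, by omega, hA⟩
    · rintro ⟨p, hp, hA⟩
      rw [mem_cell] at hA
      exact ⟨hA.1.1.trans (Finset.image_subset_image (Finset.filter_subset _ _)), hA.1.2⟩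
  rw [hun, Finset.sum_biUnion (cell_disj _)]
  refine Finset.sum_congr rfl fun p hp => ?_
  rw [Finset.mem_range] at hp
  exact cell_sum hF α β k d n z hM hk p (by omega)


def chains (Fa : Finset ℕ → Prop) (dm : Finset ℕ → ℕ) (S : Finset ℕ) (B : Finset ℕ) : Set (ℕ → Finset ℕ) :=
  {c | (∀ s ∈ S, Fa (c s) ∧ dm (c s) = s ∧ c s ⊆ B) ∧
    (∀ s ∈ S, ∀ t ∈ S, s ≤ t → c s ⊆ c t) ∧ ∀ s, s ∉ S → c s = ∅}

theorem chains_empty (Fa : Finset ℕ → Prop) (dm : Finset ℕ → ℕ) (B : Finset ℕ) :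
    chains Fa dm ∅ B = {fun _ => ∅} := by
  ext c
  simp [chains, funext_iff]

theorem chains_insert (Fa : Finset ℕ → Prop) (dm : Finset ℕ → ℕ) (S : Finset ℕ) (B : Finset ℕ) (k : ℕ)
    (hS : ∀ s ∈ S, s < k) :
    chains Fa dm (insert k S) B = ⋃ A ∈ (mfaces Fa dm k B : Set (Finset ℕ)),
      (fun c => Function.update c k A) '' chains Fa dm S A := by
  have hkS : k ∉ S := fun h => lt_irrefl _ (hS k h)
  ext c
  simp only [Set.mem_iUnion, Set.mem_image, exists_prop, Finset.mem_coe, mem_mfaces]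
  constructor
  · rintro ⟨h1, h2, h3⟩
    have hk := h1 k (Finset.mem_insert_self _ _)
    refine ⟨c k, ⟨hk.2.2, hk.1, hk.2.1⟩, Function.update c k ∅, ⟨?_, ?_, ?_⟩, by simp⟩
    · intro s hs
      have hsk := (hS s hs).ne
      rw [Function.update_of_ne hsk]
      have := h1 s (Finset.mem_insert_of_mem hs)
      exact ⟨this.1, this.2.1, h2 s (Finset.mem_insert_of_mem hs) k (Finset.mem_insert_self _ _) (hS s hs).le⟩
    · intro s hs t ht hst
      rw [Function.update_of_ne (hS s hs).ne, Function.update_of_ne (hS t ht).ne]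
      exact h2 s (Finset.mem_insert_of_mem hs) t (Finset.mem_insert_of_mem ht) hst
    · intro s hs
      by_cases hsk : s = k
      · subst hsk; simp
      · rw [Function.update_of_ne hsk]
        exact h3 s (by simp [hsk, hs])
  · rintro ⟨A, ⟨sA, fA, dA⟩, c, ⟨h1, h2, h3⟩, rfl⟩
    refine ⟨?_, ?_, ?_⟩
    · intro s hs
      rcases Finset.mem_insert.1 hs with rfl | hs
      · simp [fA, dA, sA]
      · simp only [Function.update_of_ne (hS s hs).ne]
        exact ⟨(h1 s hs).1, (h1 s hs).2.1, (h1 s hs).2.2.trans sA⟩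
    · intro s hs t ht hst
      rcases Finset.mem_insert.1 hs with hs' | hs' <;> rcases Finset.mem_insert.1 ht with ht' | ht'
      · rw [hs', ht']
      · have := hS t ht'; omega
      · subst ht'
        simp only [Function.update_of_ne (hS s hs').ne, Function.update_self]
        exact (h1 s hs').2.2
      · simp only [Function.update_of_ne (hS s hs').ne, Function.update_of_ne (hS t ht').ne]
        exact h2 s hs' t ht' hst
    · intro s hs
      rw [Finset.mem_insert, not_or] at hs
      simp only [Function.update_of_ne hs.1]
      exact h3 s hs.2

theorem chains_insert_card (Fa : Finset ℕ → Prop) (dm : Finset ℕ → ℕ) (S : Finset ℕ) (B : Finset ℕ) (k : ℕ)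
    (hS : ∀ s ∈ S, s < k) (hfin : ∀ A ∈ mfaces Fa dm k B, (chains Fa dm S A).Finite) :
    (chains Fa dm (insert k S) B).Finite ∧
    (chains Fa dm (insert k S) B).ncard = ∑ A ∈ mfaces Fa dm k B, (chains Fa dm S A).ncard := by
  have hkS : k ∉ S := fun h => lt_irrefl _ (hS k h)
  rw [chains_insert Fa dm S B k hS]
  have hf : ∀ A ∈ (mfaces Fa dm k B : Set (Finset ℕ)),
      ((fun c => Function.update c k A) '' chains Fa dm S A).Finite := fun A hA => (hfin A hA).image _
  constructor
  · exact (Finset.finite_toSet _).biUnion hf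
  · rw [(Finset.finite_toSet _).ncard_biUnion hf, finsum_mem_coe_finset]
    · refine Finset.sum_congr rfl fun A hA => ?_
      refine Set.InjOn.ncard_image ?_
      intro c hc c' hc' h
      funext s
      by_cases hs : s = k
      · subst hs
        rw [hc.2.2 _ hkS, hc'.2.2 _ hkS]
      · have := congrFun h s
        simpa [Function.update_of_ne hs] using this
    · intro A _ A' _ hne
      rw [Function.onFun, Set.disjoint_left]
      rintro _ ⟨c, -, rfl⟩ ⟨c', -, h⟩
      have := congrFun h k
      simp at this
      exact hne this.symm

theorem choose_id1 (k m : ℕ) : ((k + 1 + m - 1).choose k : ℚ) * ((k + 1 + m + 1) * (k + 1 + m)) =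
    ((k + 1 + m + 1).choose (k + 1) : ℕ) * ((k + 1) * (m + 1)) := by
  have h1 := Nat.add_one_mul_choose_eq (k + m) k
  have h2 := Nat.choose_mul_succ_eq (k + m + 1) (k + 1)
  rw [show k + m + 1 + 1 - (k + 1) = m + 1 by omega] at h2
  rw [show k + 1 + m - 1 = k + m by omega, show k + 1 + m + 1 = k + m + 1 + 1 by omega]
  have h1 := congrArg (Nat.cast : ℕ → ℚ) h1
  have h2 := congrArg (Nat.cast : ℕ → ℚ) h2
  push_cast at h1 h2 ⊢
  linear_combination (k + m + 2 : ℚ) * h1 + (k + 1 : ℚ) * h2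

theorem choose_id2 (k m : ℕ) : ((k + 1 + m - 2).choose (k + 1 + m - k) : ℚ) * ((k + 1 + m + 1) * (k + 1 + m) * (k + 1 + m - 1)) =
    ((k + 1 + m + 1).choose (k + 1) : ℕ) * ((k + 1) * k * (k - 1)) := by
  rcases k with _ | _ | k
  · rw [Nat.choose_eq_zero_of_lt (by omega)]; simp
  · rw [Nat.choose_eq_zero_of_lt (by omega)]; simp
  have h1 := Nat.add_one_mul_choose_eq (k + m + 1) k
  have h2 := Nat.add_one_mul_choose_eq (k + m + 2) (k + 1)
  have h3 := Nat.add_one_mul_choose_eq (k + m + 3) (k + 2)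
  rw [show k + 1 + 1 + 1 + m - 2 = k + m + 1 by omega, show k + 1 + 1 + 1 + m - (k + 1 + 1) = m + 1 by omega,
    show k + 1 + 1 + 1 + m + 1 = k + m + 3 + 1 by omega]
  have h0 : (k + m + 1).choose (m + 1) = (k + m + 1).choose k := by
    rw [← Nat.choose_symm (by omega : k ≤ k + m + 1)]; congr 1; omega
  rw [h0]
  have h1 := congrArg (Nat.cast : ℕ → ℚ) h1
  have h2 := congrArg (Nat.cast : ℕ → ℚ) h2
  have h3 := congrArg (Nat.cast : ℕ → ℚ) h3
  simp only [add_assoc, Nat.reduceAdd] at h1 h2 h3 ⊢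
  push_cast at h1 h2 h3 ⊢
  linear_combination (k + m + 4 : ℚ) * (k + m + 3) * h1 + (k + m + 4 : ℚ) * (k + 1 : ℚ) * h2 + (k + 1 : ℚ) * (k + 2) * h3

noncomputable def sigm {r : ℕ} (s : Fin (r + 1) → ℕ) : ℚ := ∑ j : Fin r,
          ((s j.castSucc : ℚ) + 1) * ((s j.succ : ℚ) - (s j.castSucc : ℚ)) *
            ((s j.succ : ℚ) - 1)

noncomputable def qden {r : ℕ} (s : Fin (r + 1) → ℕ) : ℚ := ((Nat.factorial (s 0 + 1) : ℚ) *
          ∏ j : Fin r, (Nat.factorial (s j.succ - s j.castSucc) : ℚ))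

noncomputable def ff {r : ℕ} (s : Fin (r + 1) → ℕ) (d : ℕ) (n : ℚ) : ℚ :=
  ((Nat.factorial (d + 1) : ℚ) / qden s) *
      (1 + (n - (d : ℚ)) / (((d : ℚ) + 1) * (d : ℚ) * ((d : ℚ) - 1)) * sigm s)

theorem qden_ne {r : ℕ} (s : Fin (r + 1) → ℕ) : qden s ≠ 0 := by
  unfold qden
  refine mul_ne_zero (by positivity) (Finset.prod_ne_zero_iff.2 fun j _ => by positivity)

theorem sigm_small {r : ℕ} (s : Fin (r + 1) → ℕ) (hs : StrictMono s) (h : s (Fin.last r) ≤ 1) : sigm s = 0 := by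
  unfold sigm
  refine Finset.sum_eq_zero fun j _ => ?_
  have h1 : s j.succ ≤ s (Fin.last r) := hs.monotone (Fin.le_last _)
  have h2 : s j.castSucc < s j.succ := hs (Fin.castSucc_lt_succ)
  have : s j.succ = 1 := by omega
  rw [this]; simp

theorem ff_rec {r : ℕ} (s : Fin (r + 2) → ℕ) (hs : StrictMono s) (D n k : ℕ) (hD : s (Fin.last (r + 1)) = D)
    (hk : s (Fin.last r).castSucc = k) (hn : D = 1 → n = 1) :
    let s' : Fin (r + 1) → ℕ := fun j => s j.castSucc
    let α : ℚ := (Nat.factorial (k + 1) : ℚ) / qden s'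
    let β : ℚ := α * (sigm s' / (((k : ℚ) + 1) * (k : ℚ) * ((k : ℚ) - 1)))
    α * ((D + 1).choose (k + 1) + ((n : ℚ) - D) * (D - 1).choose k) +
      β * (((n : ℚ) - D) * (D - 2).choose (D - k)) = ff s D n := by
  intro s' α β
  have hkD : k < D := by rw [← hk, ← hD]; exact hs (Fin.castSucc_lt_last _)
  have e1 : qden s = qden s' * (Nat.factorial (D - k) : ℚ) := by
    unfold qden
    rw [Fin.prod_univ_castSucc, ← mul_assoc]
    simp only [Fin.succ_last, hD, hk, s', Fin.castSucc_zero, Fin.succ_castSucc]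
  have e2 : sigm s = sigm s' + ((k : ℚ) + 1) * ((D : ℚ) - k) * ((D : ℚ) - 1) := by
    unfold sigm
    rw [Fin.sum_univ_castSucc]
    simp only [Fin.succ_last, hD, hk, s', Fin.succ_castSucc]
  have hs' : StrictMono s' := fun a b hab => hs (Fin.castSucc_lt_castSucc_iff.2 hab)
  have e3 : k ≤ 1 → sigm s' = 0 := fun h => sigm_small s' hs' (by simp only [s', hk]; exact h)
  have hq := qden_ne s'
  unfold ff
  rw [e1, e2]
  obtain ⟨m, rfl⟩ : ∃ m, D = k + 1 + m := ⟨D - (k + 1), by omega⟩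
  have i1 := choose_id1 k m
  have i2 := choose_id2 k m
  have i3 := Nat.choose_mul_factorial_mul_factorial (by omega : k + 1 ≤ k + 1 + m + 1)
  rw [show k + 1 + m + 1 - (k + 1) = m + 1 by omega] at i3
  have i3 := congrArg (Nat.cast : ℕ → ℚ) i3
  rw [show k + 1 + m - k = m + 1 by omega] at *
  push_cast at i1 i2 i3 ⊢
  simp only [α, β]
  have hf : ((m + 1).factorial : ℚ) ≠ 0 := by positivity
  have hf2 : ((k + 1).factorial : ℚ) ≠ 0 := by positivity
  by_cases h1 : k + 1 + m = 1
  · obtain rfl : k = 0 := by omega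
    obtain rfl : m = 0 := by omega
    have := hn rfl
    subst this
    simp [e3]
    ring
  have hm : (k + 1 + m - 1 : ℚ) ≠ 0 := by
    have : ((k + m : ℕ) : ℚ) ≠ 0 := by exact_mod_cast (by omega : k + m ≠ 0)
    push_cast at this
    intro h; apply this; linarith
  have hm1 : (k + 1 + m : ℚ) ≠ 0 := by positivity
  have hm2 : (k + 1 + m + 1 : ℚ) ≠ 0 := by positivity
  rw [← i3]
  generalize ((k + 1 + m + 1).choose (k + 1) : ℚ) = X at *
  have i1' : ((k + 1 + m - 1).choose k : ℚ) = X * ((k + 1) * (m + 1)) / ((k + 1 + m + 1) * (k + 1 + m)) := by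
    rw [eq_div_iff (by positivity)]; exact i1
  have i2' : ((k + 1 + m - 2).choose (m + 1) : ℚ) = X * ((k + 1) * k * (k - 1)) / ((k + 1 + m + 1) * (k + 1 + m) * (k + 1 + m - 1)) := by
    rw [eq_div_iff (by simp only [ne_eq, mul_eq_zero, not_or]; exact ⟨⟨hm2, hm1⟩, hm⟩)]; exact i2
  rw [i1', i2']
  by_cases hk1 : k ≤ 1
  · rw [e3 hk1]
    field_simp
    ring
  · have g1 : (k : ℚ) ≠ 0 := by exact_mod_cast (by omega : k ≠ 0)
    have g2 : (k : ℚ) - 1 ≠ 0 := by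
      intro h
      have : (k : ℚ) = 1 := by linarith
      have : k = 1 := by exact_mod_cast this
      omega
    have g3 : (k : ℚ) + 1 ≠ 0 := by positivity
    field_simp
    ring

theorem flags {Fa : Finset ℕ → Prop} {dm : Finset ℕ → ℕ} (hF : FaceSys Fa dm) (r : ℕ) :
    ∀ (s : Fin (r + 1) → ℕ), StrictMono s → ∀ B, Fa B → dm B = s (Fin.last r) →
    (dm B = 0 ∨ ∃ n z, Mux Fa dm (dm B) n z ∧ B = (Finset.range (n + 1)).image z) →
    (chains Fa dm (Finset.image (fun j : Fin r => s j.castSucc) Finset.univ) B).Finite ∧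
    ((chains Fa dm (Finset.image (fun j : Fin r => s j.castSucc) Finset.univ) B).ncard : ℚ) =
      ff s (dm B) ((B.card : ℚ) - 1) := by
  induction r with
  | zero =>
    intro s hs B fB dB _
    have : Finset.image (fun j : Fin 0 => s j.castSucc) Finset.univ = ∅ := by simp
    rw [this, chains_empty]
    refine ⟨Set.finite_singleton _, ?_⟩
    rw [Set.ncard_singleton, dB]
    have : ((s 0 + 1).factorial : ℚ) ≠ 0 := by positivity
    simp [ff, qden, sigm, this]
  | succ r ih =>
    intro s hs B fB dB hB
    set k := s (Fin.last r).castSucc with hk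
    have hkD : k < dm B := by rw [dB]; exact hs (Fin.castSucc_lt_last _)
    obtain ⟨n, z, hM, hBz⟩ : ∃ n z, Mux Fa dm (dm B) n z ∧ B = (Finset.range (n + 1)).image z := by
      rcases hB with h | h
      · omega
      · exact h
    let s' : Fin (r + 1) → ℕ := fun j => s j.castSucc
    have hs' : StrictMono s' := fun a b hab => hs (Fin.castSucc_lt_castSucc_iff.2 hab)
    have him : Finset.image (fun j : Fin (r + 1) => s j.castSucc) Finset.univ =
        insert k (Finset.image (fun j : Fin r => s' j.castSucc) Finset.univ) := by
      ext t
      simp only [Finset.mem_image, Finset.mem_univ, true_and, Finset.mem_insert, s', k]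
      constructor
      · rintro ⟨j, rfl⟩
        refine Fin.lastCases ?_ (fun j => ?_) j
        · exact Or.inl rfl
        · exact Or.inr ⟨j, rfl⟩
      · rintro (rfl | ⟨j, rfl⟩)
        · exact ⟨_, rfl⟩
        · exact ⟨_, rfl⟩
    have hlt : ∀ t ∈ Finset.image (fun j : Fin r => s' j.castSucc) Finset.univ, t < k := by
      intro t ht
      simp only [Finset.mem_image, Finset.mem_univ, true_and] at ht
      obtain ⟨j, rfl⟩ := ht
      exact hs' (Fin.castSucc_lt_last j)
    have IH : ∀ A ∈ mfaces Fa dm k B, _ := fun A hA => ih s' hs' A (mem_mfaces.1 hA).2.1 (mem_mfaces.1 hA).2.2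
      (Mux.good hF _ _ _ hM A (mem_mfaces.1 hA).2.1 (hBz ▸ (mem_mfaces.1 hA).1))
    rw [him]
    have := chains_insert_card Fa dm _ B k hlt (fun A hA => (IH A hA).1)
    refine ⟨this.1, ?_⟩
    rw [this.2, Nat.cast_sum, Finset.sum_congr rfl (fun A hA => (IH A hA).2)]
    have hcard : (B.card : ℚ) - 1 = n := by
      rw [hBz, Finset.card_image_of_injective _ hM.inj, Finset.card_range]; push_cast; ring
    rw [hcard, ← ff_rec s hs (dm B) n k dB.symm rfl hM.one, ← face_sum hF _ _ hM hkD, ← hBz]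
    refine Finset.sum_congr rfl fun A hA => ?_
    rw [(mem_mfaces.1 hA).2.2]
    unfold ff
    ring


def GF (y : ℕ → E) (V A : Finset ℕ) : Prop :=
  A ⊆ V ∧ A.Nonempty ∧ ∃ l : StrongDual ℝ E, ∃ c : ℝ, (∀ j ∈ V, l (y j) ≤ c) ∧ ∀ j ∈ V, (l (y j) = c ↔ j ∈ A)

noncomputable def gdm (y : ℕ → E) (A : Finset ℕ) : ℕ := Module.finrank ℝ (vectorSpan ℝ (y '' (A : Set ℕ)))

theorem GF.restrict {y : ℕ → E} {V A B : Finset ℕ} (h : GF y V A) (hAB : A ⊆ B) (hB : B ⊆ V) : GF y B A := by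
  obtain ⟨_, hne, l, c, h1, h2⟩ := h
  exact ⟨hAB, hne, l, c, fun j hj => h1 j (hB hj), fun j hj => h2 j (hB hj)⟩

theorem GF.trans {y : ℕ → E} {V A B : Finset ℕ} (h : GF y V B) (h' : GF y B A) : GF y V A := by
  obtain ⟨hBV, -, l, c, h1, h2⟩ := h
  obtain ⟨hAB, hne, l', c', h1', h2'⟩ := h'
  obtain ⟨N, hN⟩ := Finset.exists_le ((V \ B).image (fun j => (l' (y j) - c') / (c - l (y j))))
  refine ⟨hAB.trans hBV, hne, l' + (N + 1) • l, c' + (N + 1) * c, ?_, ?_⟩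
  all_goals
    intro j hj
    simp only [ContinuousLinearMap.add_apply, ContinuousLinearMap.smul_apply, smul_eq_mul]
    by_cases hjB : j ∈ B
    · have e := (h2 j hj).2 hjB
      rw [e]
      have a1 := h1' j hjB
      have a2 := h2' j hjB
      first
        | linarith
        | (rw [← a2]; constructor <;> intro h <;> linarith)
    · have e : l (y j) < c := lt_of_le_of_ne (h1 j hj) (fun h => hjB ((h2 j hj).1 h))
      have := hN _ (Finset.mem_image_of_mem _ (Finset.mem_sdiff.2 ⟨hj, hjB⟩))
      rw [div_le_iff₀ (by linarith)] at this
      first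
        | nlinarith
        | (constructor
           · intro h; exfalso; nlinarith
           · intro h; exact absurd (hAB h) hjB)

theorem vs_ker {y : ℕ → E} {A : Finset ℕ} {l : StrongDual ℝ E} {c : ℝ} (h : ∀ j ∈ A, l (y j) = c) :
    ∀ w ∈ vectorSpan ℝ (y '' (A : Set ℕ)), l w = 0 := by
  intro w hw
  have : vectorSpan ℝ (y '' (A : Set ℕ)) ≤ LinearMap.ker (l : E →ₗ[ℝ] ℝ) := by
    rw [vectorSpan_def, Submodule.span_le]
    rintro _ ⟨_, ⟨i, hi, rfl⟩, _, ⟨j, hj, rfl⟩, rfl⟩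
    simp [h i hi, h j hj]
  exact this hw

theorem sub_mem_vs {y : ℕ → E} {A : Finset ℕ} {i j : ℕ} (hi : i ∈ A) (hj : j ∈ A) :
    y i - y j ∈ vectorSpan ℝ (y '' (A : Set ℕ)) :=
  vsub_mem_vectorSpan ℝ (Set.mem_image_of_mem y hi) (Set.mem_image_of_mem y hj)

instance fd_vs (y : ℕ → E) (A : Finset ℕ) : FiniteDimensional ℝ (vectorSpan ℝ (y '' (A : Set ℕ))) :=
  finiteDimensional_vectorSpan_of_finite ℝ (A.finite_toSet.image y)

theorem GF.mono {y : ℕ → E} {A B : Finset ℕ} (h : GF y B A) (hAB : A ⊂ B) : gdm y A < gdm y B := by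
  obtain ⟨hs, ⟨a, ha⟩, l, c, h1, h2⟩ := h
  obtain ⟨b, hb, hbA⟩ := Finset.exists_of_ssubset hAB
  refine Submodule.finrank_lt_finrank_of_lt ?_
  refine lt_of_le_of_ne (vectorSpan_mono ℝ (Set.image_mono hs)) ?_
  intro heq
  have m1 : y b - y a ∈ vectorSpan ℝ (y '' (B : Set ℕ)) := sub_mem_vs hb (hs ha)
  rw [← heq] at m1
  have := vs_ker (fun j hj => (h2 j (hs hj)).2 hj) _ m1
  rw [map_sub, (h2 a (hs ha)).2 ha] at this
  exact hbA ((h2 b hb).1 (by linarith))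

theorem GF.inter {y : ℕ → E} {V A B : Finset ℕ} (h : GF y V A) (h' : GF y V B) (hne : (A ∩ B).Nonempty) :
    GF y V (A ∩ B) := by
  obtain ⟨hs, -, l, c, h1, h2⟩ := h
  obtain ⟨-, -, l', c', h1', h2'⟩ := h'
  refine ⟨Finset.inter_subset_left.trans hs, hne, l + l', c + c', ?_, ?_⟩
  · intro j hj
    exact add_le_add (h1 j hj) (h1' j hj)
  · intro j hj
    rw [Finset.mem_inter, ← h2 j hj, ← h2' j hj, ContinuousLinearMap.add_apply]
    have := h1 j hj
    have := h1' j hj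
    constructor
    · intro h; constructor <;> linarith
    · rintro ⟨h, h'⟩; linarith

theorem rotate (V : Finset ℕ) (v u : ℕ → ℝ) (hv : ∀ j ∈ V, 0 ≤ v j) (h0 : ∀ j ∈ V, v j = 0 → u j = 0)
    (hu : ∃ j ∈ V, 0 < u j) :
    ∃ t > 0, (∀ j ∈ V, 0 ≤ v j - t * u j) ∧ ∃ j ∈ V, 0 < u j ∧ v j - t * u j = 0 := by
  obtain ⟨j0, hj0, hpos⟩ := hu
  obtain ⟨j, hj, hmin⟩ := Finset.exists_min_image (V.filter (fun j => 0 < u j)) (fun j => v j / u j)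
    ⟨j0, by simp [hj0, hpos]⟩
  rw [Finset.mem_filter] at hj
  have hvj : 0 < v j := lt_of_le_of_ne (hv j hj.1) (fun h => by have := h0 j hj.1 h.symm; linarith [hj.2])
  refine ⟨v j / u j, div_pos hvj hj.2, ?_, j, hj.1, hj.2, ?_⟩
  · intro i hi
    by_cases hui : 0 < u i
    · have := hmin i (by simp [hi, hui])
      rw [le_div_iff₀ hui] at this
      linarith
    · have := hv i hi
      have h3 : 0 < v j / u j := div_pos hvj hj.2
      nlinarith
  · rw [div_mul_cancel₀ _ hj.2.ne', sub_self]

theorem GF.two {y : ℕ → E} {A C B : Finset ℕ} (hA : GF y B A) (hC : GF y B C) (hAC : A ⊂ C) (hCB : C ⊂ B) :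
    ∃ D, GF y B D ∧ A ⊆ D ∧ D ⊂ B ∧ ¬ D ⊆ C := by
  obtain ⟨hs, hne, l, c, h1, h2⟩ := hA
  obtain ⟨hs', -, l', c', h1', h2'⟩ := hC
  obtain ⟨b, hb, hbC⟩ := Finset.exists_of_ssubset hCB
  obtain ⟨e, he, heA⟩ := Finset.exists_of_ssubset hAC
  obtain ⟨t, ht, hge, j, hj, huj, hvj⟩ := rotate B (fun j => c - l (y j)) (fun j => c' - l' (y j))
    (fun j hj => sub_nonneg.2 (h1 j hj))
    (fun j hj h => by
      have : j ∈ A := (h2 j hj).1 (by linarith)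
      have := (h2' j hj).2 (hAC.subset this)
      simp [this])
    ⟨b, hb, sub_pos.2 (lt_of_le_of_ne (h1' b hb) (fun h => hbC ((h2' b hb).1 h)))⟩
  have hAD : A ⊆ B.filter (fun j => c - l (y j) - t * (c' - l' (y j)) = 0) := by
    intro i hi
    rw [Finset.mem_filter]
    refine ⟨hs hi, ?_⟩
    rw [(h2 i (hs hi)).2 hi, (h2' i (hs hi)).2 (hAC.subset hi)]
    ring
  refine ⟨B.filter (fun j => c - l (y j) - t * (c' - l' (y j)) = 0), ⟨Finset.filter_subset _ _, hne.mono hAD,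
    l - t • l', c - t * c', ?_, ?_⟩, hAD, ?_, ?_⟩
  · intro i hi
    have := hge i hi
    simp only [ContinuousLinearMap.sub_apply, ContinuousLinearMap.smul_apply, smul_eq_mul]
    linarith
  · intro i hi
    simp only [ContinuousLinearMap.sub_apply, ContinuousLinearMap.smul_apply, smul_eq_mul, Finset.mem_filter, hi, true_and]
    constructor <;> intro h <;> linarith
  · refine (Finset.filter_subset _ _).ssubset_of_ne ?_
    intro h
    have : e ∈ B.filter (fun j => c - l (y j) - t * (c' - l' (y j)) = 0) := by rw [h]; exact hs' he
    rw [Finset.mem_filter, (h2' e (hs' he)).2 he] at this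
    exact heA ((h2 e (hs' he)).1 (by linarith [this.2]))
  · intro h
    have := h (Finset.mem_filter.2 ⟨hj, hvj⟩)
    have := (h2' j hj).2 this
    linarith

theorem exists_functional {U W : Submodule ℝ E} [FiniteDimensional ℝ W] (hUW : U ≤ W) {w : E} (hw : w ∈ W) (hwU : w ∉ U) :
    ∃ m : StrongDual ℝ E, (∀ x ∈ U, m x = 0) ∧ m w ≠ 0 := by
  obtain ⟨f, hf, hU⟩ := Submodule.exists_le_ker_of_notMem hwU
  obtain ⟨g, hg, -⟩ := exists_extension_norm_eq W (LinearMap.toContinuousLinearMap (f.domRestrict W))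
  refine ⟨g, ?_, ?_⟩
  · intro x hx
    have := hg ⟨x, hUW hx⟩
    simp at this
    rw [this]
    exact hU hx
  · have := hg ⟨w, hw⟩
    simp at this
    rw [this]
    exact hf

theorem GF.bigger {y : ℕ → E} {A B : Finset ℕ} (hA : GF y B A) (hAB : A ⊂ B) (hd : gdm y A + 1 < gdm y B) :
    ∃ A', GF y B A' ∧ A ⊂ A' ∧ A' ⊂ B := by
  obtain ⟨hs, ⟨a, ha⟩, l, c, h1, h2⟩ := hA
  obtain ⟨b, hb, hbA⟩ := Finset.exists_of_ssubset hAB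
  have hUW : vectorSpan ℝ (y '' (A : Set ℕ)) ≤ vectorSpan ℝ (y '' (B : Set ℕ)) := vectorSpan_mono ℝ (Set.image_mono hs)
  have lU := vs_ker (fun j hj => (h2 j (hs hj)).2 hj)
  have hle : l (y b - y a) ≠ 0 := by
    intro h
    rw [map_sub, (h2 a (hs ha)).2 ha] at h
    exact hbA ((h2 b hb).1 (by linarith))
  obtain ⟨w, hwW, hlw, hwU⟩ : ∃ w ∈ vectorSpan ℝ (y '' (B : Set ℕ)), l w = 0 ∧ w ∉ vectorSpan ℝ (y '' (A : Set ℕ)) := by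
    by_contra! hcon
    have hWU : vectorSpan ℝ (y '' (B : Set ℕ)) ≤ vectorSpan ℝ (y '' (A : Set ℕ)) ⊔ Submodule.span ℝ {y b - y a} := by
      intro w hw
      have e : w = (w - (l w / l (y b - y a)) • (y b - y a)) + (l w / l (y b - y a)) • (y b - y a) := by abel
      rw [e]
      refine Submodule.add_mem_sup ?_ (Submodule.smul_mem _ _ (Submodule.mem_span_singleton_self _))
      refine hcon _ (Submodule.sub_mem _ hw (Submodule.smul_mem _ _ (sub_mem_vs hb (hs ha)))) ?_
      rw [map_sub, map_smul, smul_eq_mul, div_mul_cancel₀ _ hle, sub_self]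
    have f1 := Submodule.finrank_mono hWU
    have f2 := Submodule.finrank_add_le_finrank_add_finrank (vectorSpan ℝ (y '' (A : Set ℕ))) (Submodule.span ℝ {y b - y a})
    have f3 := finrank_span_singleton (K := ℝ) (v := y b - y a) (by intro h; rw [h] at hle; simp at hle)
    unfold gdm at hd
    omega
  obtain ⟨m, hmU, hmw, j0, hj0, hpos⟩ : ∃ m : StrongDual ℝ E, (∀ x ∈ vectorSpan ℝ (y '' (A : Set ℕ)), m x = 0) ∧ m w ≠ 0 ∧
      ∃ j ∈ B, 0 < m (y j) - m (y a) := by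
    obtain ⟨m, hmU, hmw⟩ := exists_functional hUW hwW hwU
    obtain ⟨j, hj, hne⟩ : ∃ j ∈ B, m (y j) ≠ m (y a) := by
      by_contra! hcon
      exact hmw (vs_ker hcon w hwW)
    rcases lt_or_gt_of_ne hne with h | h
    · refine ⟨-m, fun x hx => by simp [hmU x hx], by simpa using hmw, j, hj, ?_⟩
      simp only [ContinuousLinearMap.neg_apply]; linarith
    · exact ⟨m, hmU, hmw, j, hj, by linarith⟩
  have hmA : ∀ j ∈ A, m (y j) - m (y a) = 0 := by
    intro j hj
    rw [← map_sub]
    exact hmU _ (sub_mem_vs hj ha)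
  obtain ⟨t, ht, hge, j, hj, huj, hvj⟩ := rotate B (fun j => c - l (y j)) (fun j => m (y j) - m (y a))
    (fun j hj => sub_nonneg.2 (h1 j hj))
    (fun j hj h => hmA j ((h2 j hj).1 (by linarith))) ⟨j0, hj0, hpos⟩
  have hAD : A ⊆ B.filter (fun j => c - l (y j) - t * (m (y j) - m (y a)) = 0) := by
    intro i hi
    rw [Finset.mem_filter]
    refine ⟨hs hi, ?_⟩
    rw [(h2 i (hs hi)).2 hi, hmA i hi]
    ring
  refine ⟨B.filter (fun j => c - l (y j) - t * (m (y j) - m (y a)) = 0), ⟨Finset.filter_subset _ _, ⟨a, hAD ha⟩,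
    l + t • m, c + t * m (y a), ?_, ?_⟩, ?_, ?_⟩
  · intro i hi
    have := hge i hi
    simp only [ContinuousLinearMap.add_apply, ContinuousLinearMap.smul_apply, smul_eq_mul]
    linarith
  · intro i hi
    simp only [ContinuousLinearMap.add_apply, ContinuousLinearMap.smul_apply, smul_eq_mul, Finset.mem_filter, hi, true_and]
    constructor <;> intro h <;> linarith
  · refine hAD.ssubset_of_ne ?_
    intro h
    have : j ∈ A := by rw [h]; exact Finset.mem_filter.2 ⟨hj, hvj⟩
    have := hmA j this
    linarith
  · refine (Finset.filter_subset _ _).ssubset_of_ne ?_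
    intro h
    have hall : ∀ i ∈ B, (l + t • m) (y i) = c + t * m (y a) := by
      intro i hi
      rw [← h, Finset.mem_filter] at hi
      simp only [ContinuousLinearMap.add_apply, ContinuousLinearMap.smul_apply, smul_eq_mul]
      linarith [hi.2]
    have := vs_ker hall w hwW
    simp only [ContinuousLinearMap.add_apply, ContinuousLinearMap.smul_apply, smul_eq_mul, hlw, zero_add, mul_eq_zero] at this
    rcases this with h | h
    · exact ht.ne' h
    · exact hmw h

theorem GF.facet {y : ℕ → E} {B : Finset ℕ} (N : ℕ) : ∀ A, GF y B A → A ⊂ B → gdm y B - gdm y A ≤ N →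
    ∃ C, GF y B C ∧ A ⊆ C ∧ C ⊂ B ∧ gdm y C + 1 = gdm y B := by
  induction N with
  | zero =>
    intro A hA hAB h
    have := hA.mono hAB
    omega
  | succ N ih =>
    intro A hA hAB h
    have h1 := hA.mono hAB
    by_cases h2 : gdm y A + 1 = gdm y B
    · exact ⟨A, hA, subset_rfl, hAB, h2⟩
    · obtain ⟨A', hA', s1, s2⟩ := hA.bigger hAB (by omega)
      have h3 := (hA.restrict s1.subset s2.subset).mono s1
      obtain ⟨C, c1, c2, c3⟩ := ih A' hA' s2 (by omega)
      exact ⟨C, c1, s1.subset.trans c2, c3⟩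

theorem GF.faceSys (y : ℕ → E) (V : Finset ℕ) : FaceSys (GF y V) (gdm y) where
  ne A h := h.2.1
  mono A B hA hB h := (hA.restrict h.subset hB.1).mono h
  inter A B hA hB h := hA.inter hB h
  facet A B hA hB h := by
    obtain ⟨C, c1, c2, c3⟩ := GF.facet _ A (hA.restrict h.subset hB.1) h le_rfl
    exact ⟨C, hB.trans c1, c2, c3⟩
  two A C B hA hC hB h1 h2 := by
    obtain ⟨D, c1, c2⟩ := GF.two (hA.restrict (h1.trans h2).subset hB.1) (hC.restrict h2.subset hB.1) h1 h2
    exact ⟨D, hB.trans c1, c2⟩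


def hullF (y : ℕ → E) (A : Finset ℕ) : Set E := convexHull ℝ (y '' (A : Set ℕ))

theorem mem_hullF {y : ℕ → E} {A : Finset ℕ} {j : ℕ} (h : j ∈ A) : y j ∈ hullF y A :=
  subset_convexHull ℝ _ (Set.mem_image_of_mem y h)

theorem hullF_mono {y : ℕ → E} {A B : Finset ℕ} (h : A ⊆ B) : hullF y A ⊆ hullF y B :=
  convexHull_mono (Set.image_mono (by exact_mod_cast h))

theorem hull_slice1 {y : ℕ → E} {V A : Finset ℕ} {l : StrongDual ℝ E} {c : ℝ}
    (h1 : ∀ j ∈ V, l (y j) ≤ c) (h2 : ∀ j ∈ V, (l (y j) = c → j ∈ A)) :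
    ∀ x ∈ hullF y V, l x ≤ c ∧ (l x = c → x ∈ hullF y A) := by
  have hT : Convex ℝ {x : E | l x ≤ c ∧ (l x = c → x ∈ hullF y A)} := by
    rw [convex_iff_forall_pos]
    rintro u ⟨hu, hu'⟩ v ⟨hv, hv'⟩ a b ha hb hab
    simp only [Set.mem_ofPred_eq, map_add, map_smul, smul_eq_mul]
    have ec : c = a * c + b * c := by rw [← add_mul, hab, one_mul]
    have e1 := mul_le_mul_of_nonneg_left hu ha.le
    have e2 := mul_le_mul_of_nonneg_left hv hb.le
    refine ⟨by linarith, fun h => ?_⟩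
    have e3 : a * l u = a * c := by linarith
    have e4 : b * l v = b * c := by linarith
    exact (convex_convexHull ℝ _) (hu' (mul_left_cancel₀ ha.ne' e3)) (hv' (mul_left_cancel₀ hb.ne' e4)) ha.le hb.le hab
  intro x hx
  refine convexHull_min ?_ hT hx
  rintro _ ⟨j, hj, rfl⟩
  exact ⟨h1 j hj, fun h => mem_hullF (h2 j hj h)⟩

theorem hull_slice2 {y : ℕ → E} {A : Finset ℕ} {l : StrongDual ℝ E} {c : ℝ}
    (h : ∀ j ∈ A, l (y j) = c) : ∀ x ∈ hullF y A, l x = c := by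
  intro x hx
  have := convexHull_min (s := y '' (A : Set ℕ)) (t := {x : E | l x = c}) (by
    rintro _ ⟨j, hj, rfl⟩
    exact h j hj) (convex_hyperplane (l : E →ₗ[ℝ] ℝ).isLinear c)
  exact this hx

theorem GF.isFace {y : ℕ → E} {V A : Finset ℕ} (h : GF y V A) : IsFaceOf (hullF y V) (hullF y A) := by
  obtain ⟨hAV, ⟨a, ha⟩, l, c, h1, h2⟩ := h
  refine ⟨fun _ => ⟨l, ?_⟩, ⟨y a, mem_hullF ha⟩⟩
  have s1 := hull_slice1 h1 (fun j hj => (h2 j hj).1)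
  have s2 := hull_slice2 (y := y) (A := A) (l := l) (c := c) (fun j hj => (h2 j (hAV hj)).2 hj)
  ext x
  constructor
  · intro hx
    exact ⟨hullF_mono hAV hx, fun z hz => by rw [s2 x hx]; exact (s1 z hz).1⟩
  · rintro ⟨hx, hm⟩
    refine (s1 x hx).2 (le_antisymm (s1 x hx).1 ?_)
    have := hm (y a) (mem_hullF (hAV ha))
    rwa [(h2 a (hAV ha)).2 ha] at this

theorem isFace_GF {y : ℕ → E} {V : Finset ℕ} {F : Set E} (h : IsFaceOf (hullF y V) F) :
    ∃ A, GF y V A ∧ F = hullF y A := by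
  classical
  obtain ⟨hexp, hne⟩ := h
  obtain ⟨l, hl⟩ := hexp hne
  obtain ⟨x0, hx0⟩ := hne
  have hx0' := hx0
  rw [hl] at hx0'
  obtain ⟨hxV, hxm⟩ := hx0'
  have h1 : ∀ j ∈ V, l (y j) ≤ l x0 := fun j hj => hxm _ (mem_hullF hj)
  have h2 : ∀ j ∈ V, (l (y j) = l x0 ↔ j ∈ V.filter (fun j => l (y j) = l x0)) := by
    intro j hj; simp [hj]
  have s1 := hull_slice1 h1 (fun j hj => (h2 j hj).1)
  have hx : x0 ∈ hullF y (V.filter (fun j => l (y j) = l x0)) := (s1 x0 hxV).2 rfl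
  have hG : GF y V (V.filter (fun j => l (y j) = l x0)) := by
    refine ⟨Finset.filter_subset _ _, ?_, l, l x0, h1, h2⟩
    by_contra hcon
    rw [Finset.not_nonempty_iff_eq_empty] at hcon
    rw [hcon] at hx
    simp [hullF] at hx
  refine ⟨_, hG, ?_⟩
  have s2 := hull_slice2 (y := y) (A := V.filter (fun j => l (y j) = l x0)) (l := l) (c := l x0)
    (fun j hj => (Finset.mem_filter.1 hj).2)
  ext x
  rw [hl]
  constructor
  · rintro ⟨hx, hm⟩
    exact (s1 x hx).2 (le_antisymm (s1 x hx).1 (hm x0 hxV))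
  · intro hx
    exact ⟨hullF_mono (Finset.filter_subset _ _) hx, fun z hz => by rw [s2 x hx]; exact (s1 z hz).1⟩

theorem GF.mem_hull {y : ℕ → E} {V A : Finset ℕ} (h : GF y V A) {j : ℕ} (hj : j ∈ V) : y j ∈ hullF y A ↔ j ∈ A := by
  obtain ⟨hAV, -, l, c, h1, h2⟩ := h
  refine ⟨fun hx => (h2 j hj).1 (hull_slice2 (fun j hj => (h2 j (hAV hj)).2 hj) _ hx), mem_hullF⟩

theorem GF.sub_iff {y : ℕ → E} {V A B : Finset ℕ} (hA : GF y V A) (hB : GF y V B) :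
    hullF y A ⊆ hullF y B ↔ A ⊆ B := by
  refine ⟨fun h j hj => (hB.mem_hull (hA.1 hj)).1 (h (mem_hullF hj)), hullF_mono⟩

theorem GF.hull_inj {y : ℕ → E} {V A B : Finset ℕ} (hA : GF y V A) (hB : GF y V B) (h : hullF y A = hullF y B) : A = B :=
  Finset.Subset.antisymm ((hA.sub_iff hB).1 h.le) ((hB.sub_iff hA).1 h.ge)

theorem pdim_hullF (y : ℕ → E) (A : Finset ℕ) : pdim (hullF y A) = gdm y A := by
  unfold pdim gdm hullF
  rw [affineSpan_convexHull, direction_affineSpan]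

theorem hullF_empty (y : ℕ → E) : hullF y ∅ = ∅ := by simp [hullF]

theorem flagNum_eq (y : ℕ → E) (V : Finset ℕ) (S : Finset ℕ) :
    flagNum (hullF y V) S = (chains (GF y V) (gdm y) S V).ncard := by
  classical
  unfold flagNum
  have : {c : ℕ → Set E | (∀ s ∈ S, IsFaceOf (hullF y V) (c s) ∧ pdim (c s) = s) ∧
    (∀ s ∈ S, ∀ t ∈ S, s ≤ t → c s ⊆ c t) ∧ ∀ s, s ∉ S → c s = ∅} =
      (fun (c : ℕ → Finset ℕ) s => hullF y (c s)) '' chains (GF y V) (gdm y) S V := by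
    ext c
    constructor
    · rintro ⟨h1, h2, h3⟩
      have hex : ∀ s, ∃ A, (s ∈ S → GF y V A) ∧ (s ∉ S → A = ∅) ∧ c s = hullF y A := by
        intro s
        by_cases hs : s ∈ S
        · obtain ⟨A, hA, e⟩ := isFace_GF (h1 s hs).1
          exact ⟨A, fun _ => hA, fun h => absurd hs h, e⟩
        · exact ⟨∅, fun h => absurd h hs, fun _ => rfl, by rw [h3 s hs, hullF_empty]⟩
      choose g hg1 hg2 hg3 using hex
      refine ⟨g, ⟨fun s hs => ⟨hg1 s hs, ?_, (hg1 s hs).1⟩, fun s hs t ht hst => ?_, hg2⟩, ?_⟩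
      · rw [← pdim_hullF, ← hg3]; exact (h1 s hs).2
      · rw [← (hg1 s hs).sub_iff (hg1 t ht), ← hg3, ← hg3]; exact h2 s hs t ht hst
      · funext s; exact (hg3 s).symm
    · rintro ⟨g, ⟨h1, h2, h3⟩, rfl⟩
      refine ⟨fun s hs => ⟨(h1 s hs).1.isFace, ?_⟩, fun s hs t ht hst => hullF_mono (h2 s hs t ht hst), fun s hs => ?_⟩
      · simp only [pdim_hullF]; exact (h1 s hs).2.1
      · simp only [h3 s hs, hullF_empty]
  rw [this]
  refine Set.InjOn.ncard_image ?_
  rintro g ⟨h1, h2, h3⟩ g' ⟨h1', h2', h3'⟩ e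
  funext s
  have e' := congrFun e s
  by_cases hs : s ∈ S
  · exact (h1 s hs).1.hull_inj (h1' s hs).1 e'
  · rw [h3 s hs, h3' s hs]

theorem image_V (x : ℤ → E) (n : ℕ) :
    x '' Icc (0:ℤ) (n:ℤ) = (fun j : ℕ => x j) '' ((Finset.range (n + 1) : Finset ℕ) : Set ℕ) := by
  ext p
  constructor
  · rintro ⟨j, ⟨h0, h1⟩, rfl⟩
    exact ⟨j.toNat, by simp; omega, by simp [h0]⟩
  · rintro ⟨j, hj, rfl⟩
    simp at hj
    exact ⟨j, ⟨by omega, by omega⟩, rfl⟩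

theorem image_Fset {d n : ℕ} {P : Set E} {x : ℤ → E} (hM : IsMultiplex d n P x) {i : ℕ} (hi : i ≤ n) :
    x '' (Icc ((i:ℤ) - d + 1) ((i:ℤ) + d - 1) \ {(i:ℤ)}) = (fun j : ℕ => x j) '' ((Fset d n i : Finset ℕ) : Set ℕ) := by
  have hd := hM.two_le_d
  have hn := hM.d_le_n
  ext p
  constructor
  · rintro ⟨j, ⟨⟨h0, h1⟩, h2⟩, rfl⟩
    simp only [Set.mem_singleton_iff] at h2
    rcases le_or_gt j 0 with hj | hj
    · refine ⟨0, ?_, by simpa using (hM.clamp_lo j hj).symm⟩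
      rw [Finset.mem_coe, mem_Fset]; omega
    · rcases le_or_gt (n:ℤ) j with hj' | hj'
      · refine ⟨n, ?_, by simpa using (hM.clamp_hi j hj').symm⟩
        rw [Finset.mem_coe, mem_Fset]; omega
      · refine ⟨j.toNat, ?_, by simp [hj.le]⟩
        rw [Finset.mem_coe, mem_Fset]; omega
  · rintro ⟨j, hj, rfl⟩
    rw [Finset.mem_coe, mem_Fset] at hj
    obtain ⟨a, b, c, h⟩ := hj
    by_cases hji : j = i
    · subst hji
      rcases h with h | h | h
      · exact absurd rfl h
      · refine ⟨-1, ⟨⟨by omega, by omega⟩, by rw [Set.mem_singleton_iff]; omega⟩, ?_⟩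
        subst h
        simpa using hM.clamp_lo (-1) (by omega)
      · refine ⟨n + 1, ⟨⟨by omega, by omega⟩, by rw [Set.mem_singleton_iff]; omega⟩, ?_⟩
        subst h
        exact hM.clamp_hi _ (by omega)
    · exact ⟨j, ⟨⟨by omega, by omega⟩, by simp; omega⟩, rfl⟩

theorem IsMultiplex.mux {d n : ℕ} {P : Set E} {x : ℤ → E} (hM : IsMultiplex d n P x) :
    Mux (GF (fun j : ℕ => x j) (Finset.range (n + 1))) (gdm (fun j : ℕ => x j)) d n id := by
  set y : ℕ → E := fun j : ℕ => x j with hy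
  set V := Finset.range (n + 1) with hV
  have hP : P = hullF y V := by rw [hM.hull, image_V]; rfl
  have hd := hM.two_le_d
  have hyinj : ∀ i ∈ V, ∀ j ∈ V, y i = y j → i = j := by
    intro i hi j hj e
    simp [hV] at hi hj
    have := hM.inj (x₁ := (i:ℤ)) (x₂ := (j:ℤ)) ⟨by omega, by omega⟩ ⟨by omega, by omega⟩ e
    omega
  -- a vertex in the hull of a subset belongs to the subset
  have hvert : ∀ A ⊆ V, ∀ j ∈ V, y j ∈ hullF y A → j ∈ A := by
    intro A hA j hj hmem
    have h1 : y j ∈ extremePoints ℝ P := by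
      rw [hM.verts, image_V]; exact Set.mem_image_of_mem y hj
    have h2 : y j ∈ extremePoints ℝ (hullF y A) := by
      refine inter_extremePoints_subset_extremePoints_of_subset ?_ ⟨hmem, h1⟩
      rw [hP]; exact hullF_mono hA
    obtain ⟨k, hk, e⟩ := extremePoints_convexHull_subset h2
    rwa [← hyinj k (hA hk) j hj e]
  have hFV : ∀ i, Fset d n i ⊆ V := by
    intro i j hj
    rw [mem_Fset] at hj
    simp [hV]; omega
  have hfac : ∀ F, (IsFaceOf P F ∧ pdim F = d - 1) ↔ ∃ i ≤ n, F = hullF y (Fset d n i) := by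
    intro F
    rw [hM.facets]
    constructor
    · rintro ⟨i, ⟨h0, h1⟩, e⟩
      lift i to ℕ using h0
      have hi : i ≤ n := by omega
      exact ⟨i, hi, by rw [e, image_Fset hM hi]; rfl⟩
    · rintro ⟨i, hi, e⟩
      exact ⟨i, ⟨by omega, by omega⟩, by rw [e, image_Fset hM hi]; rfl⟩
  refine ⟨by omega, hM.d_le_n, by omega, Function.injective_id, ?_, ?_, ?_⟩
  · rw [Finset.image_id]
    exact ⟨Finset.Subset.refl _, ⟨0, by simp [hV]⟩, 0, 0, by simp, fun j hj => ⟨fun _ => hj, fun _ => by simp⟩⟩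
  · rw [Finset.image_id, ← pdim_hullF, ← hP, hM.dim]
  · intro C
    simp only [Finset.image_id]
    constructor
    · rintro ⟨hC, hCV, hdC⟩
      obtain ⟨i, hi, e⟩ := (hfac (hullF y C)).1 ⟨by rw [hP]; exact hC.isFace, by rw [pdim_hullF]; omega⟩
      refine ⟨i, hi, Finset.Subset.antisymm (fun j hj => ?_) (fun j hj => ?_)⟩
      · exact hvert _ (hFV i) j (hCV hj) (e ▸ mem_hullF hj)
      · exact hvert _ hCV j (hFV i hj) (e ▸ mem_hullF hj)
    · rintro ⟨i, hi, rfl⟩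
      obtain ⟨h1, h2⟩ := (hfac _).2 ⟨i, hi, rfl⟩
      rw [hP] at h1
      obtain ⟨A, hA, e⟩ := isFace_GF h1
      have : Fset d n i = A := by
        refine Finset.Subset.antisymm (fun j hj => ?_) (fun j hj => ?_)
        · exact hvert _ hA.1 j (hFV i hj) (e ▸ mem_hullF hj)
        · exact hvert _ (hFV i) j (hA.1 hj) (e ▸ mem_hullF hj)
      rw [pdim_hullF] at h2
      exact ⟨this ▸ hA, hFV i, by omega⟩

/-- The flag vector of the multiplex: for `S = {s_1 < … < s_r} ⊆ {0,…,d-1}`,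
encoded by the strictly increasing function `s : Fin (r+1) → ℕ` with
`s_j = s (j-1)` for `1 ≤ j ≤ r` and `s_{r+1} = s r = d`,
`f_S(M^{d,n})` equals the multinomial coefficient
`(d+1)! / ((s_1+1)!·(s_2-s_1)!· … ·(s_r-s_{r-1})!·(d-s_r)!)` times
`1 + (n-d)/((d+1)d(d-1)) · Σ_{j=1}^r (s_j+1)(s_{j+1}-s_j)(s_{j+1}-1)`. -/
theorem multiplex_flag_vector (d n : ℕ) (hd : 2 ≤ d) (hdn : d ≤ n)
    (P : Set E) (x : ℤ → E) (hM : IsMultiplex d n P x)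
    (r : ℕ) (s : Fin (r + 1) → ℕ) (hs : StrictMono s) (hlast : s (Fin.last r) = d) :
    (flagNum P (Finset.image (fun j : Fin r => s j.castSucc) Finset.univ) : ℚ) =
      ((Nat.factorial (d + 1) : ℚ) /
        ((Nat.factorial (s 0 + 1) : ℚ) *
          ∏ j : Fin r, (Nat.factorial (s j.succ - s j.castSucc) : ℚ))) *
      (1 + ((n : ℚ) - (d : ℚ)) / (((d : ℚ) + 1) * (d : ℚ) * ((d : ℚ) - 1)) *
        ∑ j : Fin r,
          ((s j.castSucc : ℚ) + 1) * ((s j.succ : ℚ) - (s j.castSucc : ℚ)) *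
            ((s j.succ : ℚ) - 1)) := by
  have hP : P = hullF (fun j : ℕ => x j) (Finset.range (n + 1)) := by rw [hM.hull, image_V]; rfl
  have hX := hM.mux
  have hface := hX.face
  have hdim := hX.dim
  rw [Finset.image_id] at hface hdim
  have h := (flags (GF.faceSys (fun j : ℕ => x j) (Finset.range (n + 1))) r s hs (Finset.range (n + 1)) hface
    (by rw [hdim, hlast]) (Or.inr ⟨n, id, by rw [hdim]; exact hX, by rw [Finset.image_id]⟩)).2
  rw [hP, flagNum_eq, h, hdim]
  unfold ff qden sigm
  simp
end
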